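/- arXiv:1210.0590 — 9 statements merged into one kernel-verified Lean document; each statement's English description precedes it below -/
import Mathlib

section
/- For every nonempty closed subset S of ℝⁿ there exists a sequence (S_i)_{i∈ℤ} of nonempty closed sets with S_{i+1} ⊆ S_i ⊆ S for every i ∈ ℤ, such that for every i ∈ ℤ: (i) the points of S_i are 2^i-separated, i.e., any two distinct points x, y ∈ S_i satisfy ‖x − y‖ ≥ 2^i; and (ii) S_i is a 2^{i+1}-net in S, i.e., for every x ∈ S there exists a ∈ S_i with ‖x − a‖ ≤ 2^{i+1}. -/
open Filter Topology

/-- Every set in a metric space contains an `ε`-separated `ε`-net of itself. -/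
theorem exists_separated_net {X : Type*} [PseudoMetricSpace X] {ε : ℝ} (hε : 0 ≤ ε) (s : Set X) :
    ∃ t ⊆ s, t.Pairwise (fun x y => ε ≤ dist x y) ∧ ∀ x ∈ s, ∃ a ∈ t, dist x a ≤ ε := by
  obtain ⟨t, ht⟩ := zorn_subset {t : Set X | t ⊆ s ∧ t.Pairwise (fun x y => ε ≤ dist x y)} (by
    intro c hc hchain
    refine ⟨⋃₀ c, ⟨Set.sUnion_subset fun t ht => (hc ht).1, ?_⟩,
      fun t ht => Set.subset_sUnion_of_mem ht⟩
    exact (Set.pairwise_sUnion hchain.directedOn).2 fun t ht => (hc ht).2)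
  refine ⟨t, ht.prop.1, ht.prop.2, fun x hx => ?_⟩
  by_contra! h
  have hxt : x ∉ t := fun hxt => (h x hxt).not_ge (by simpa using hε)
  have hins : insert x t ∈ {t : Set X | t ⊆ s ∧ t.Pairwise (fun x y => ε ≤ dist x y)} := by
    refine ⟨Set.insert_subset hx ht.prop.1, ht.prop.2.insert fun y hy _ => ⟨(h y hy).le, ?_⟩⟩
    rw [dist_comm]
    exact (h y hy).le
  exact hxt (ht.le_of_ge hins (Set.subset_insert x t) (Set.mem_insert x t))

/-- Nested dyadic nets at all scales `2 ^ i` with `m ≤ i`. -/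
theorem exists_nested_dyadic_nets_from {X : Type*} [PseudoMetricSpace X] (s : Set X) (m : ℤ) :
    ∃ T : ℤ → Set X, (∀ i, T i ⊆ s) ∧ (∀ i, m ≤ i → T (i + 1) ⊆ T i) ∧
      (∀ i, m ≤ i → (T i).Pairwise fun x y => (2 : ℝ) ^ i ≤ dist x y) ∧
      ∀ i, m ≤ i → ∀ x ∈ s, ∃ a ∈ T i, dist x a ≤ (2 : ℝ) ^ (i + 1) := by
  choose net hsub hsep hnet using fun (i : ℤ) (t : Set X) =>
    exists_separated_net (zpow_nonneg (zero_le_two : (0 : ℝ) ≤ 2) i) t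
  let R : ℕ → Set X := fun k => Nat.rec (net m s) (fun j t => net (m + (j + 1 : ℕ)) t) k
  have hR : ∀ k, R (k + 1) = net (m + (k + 1 : ℕ)) (R k) := fun _ => rfl
  have hRs : ∀ k, R k ⊆ s := by
    intro k
    induction k with
    | zero => exact hsub m s
    | succ k ih => exact (hsub _ _).trans ih
  have hRsep : ∀ k : ℕ, (R k).Pairwise fun x y => (2 : ℝ) ^ (m + k) ≤ dist x y := by
    intro k
    cases k with
    | zero => simpa [show R 0 = net m s from rfl] using hsep m s
    | succ k => exact hsep _ _
  have hRnet : ∀ k : ℕ, ∀ x ∈ s, ∃ a ∈ R k, dist x a ≤ (2 : ℝ) ^ (m + k + 1) := by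
    intro k
    induction k with
    | zero =>
      intro x hx
      obtain ⟨a, ha, hxa⟩ := hnet m s x hx
      exact ⟨a, ha, hxa.trans (zpow_le_zpow_right₀ one_le_two (by simp))⟩
    | succ k ih =>
      intro x hx
      obtain ⟨b, hb, hxb⟩ := ih x hx
      obtain ⟨a, ha, hba⟩ := hnet (m + (k + 1 : ℕ)) (R k) b hb
      refine ⟨a, ha, (dist_triangle x b a).trans ((add_le_add hxb hba).trans_eq ?_)⟩
      rw [zpow_add_one₀ two_ne_zero (m + (k + 1 : ℕ)), mul_two]
      push_cast
      rw [add_assoc]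
  refine ⟨fun i => R (i - m).toNat, fun i => hRs _, fun i hi => ?_, fun i hi => ?_, fun i hi => ?_⟩
  · have h : (i + 1 - m).toNat = (i - m).toNat + 1 := by omega
    simp only [h, hR]
    exact hsub _ _
  · simpa [hi] using hRsep (i - m).toNat
  · simpa [hi] using hRnet (i - m).toNat

/-- The limits along `l` of families of points lying eventually in the sets `A`. -/
def limitSet {ι X : Type*} [TopologicalSpace X] (l : Filter ι) (A : ι → Set X) : Set X :=
  {x | ∃ f : ι → X, (∀ᶠ k in l, f k ∈ A k) ∧ Tendsto f l (𝓝 x)}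

theorem limitSet_mono {ι X : Type*} [TopologicalSpace X] {l : Filter ι} {A B : ι → Set X}
    (h : ∀ᶠ k in l, A k ⊆ B k) : limitSet l A ⊆ limitSet l B := by
  rintro x ⟨f, hf, hx⟩
  exact ⟨f, h.mp (hf.mono fun k hk hAB => hAB hk), hx⟩

theorem limitSet_subset_of_isClosed {ι X : Type*} [TopologicalSpace X] {l : Filter ι} [l.NeBot]
    {A : ι → Set X} {s : Set X} (hs : IsClosed s) (h : ∀ᶠ k in l, A k ⊆ s) :
    limitSet l A ⊆ s := by
  rintro x ⟨f, hf, hx⟩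
  exact hs.mem_of_tendsto hx (h.mp (hf.mono fun k hk hA => hA hk))

theorem pairwise_le_dist_limitSet {ι X : Type*} [MetricSpace X] {l : Filter ι} [l.NeBot]
    {A : ι → Set X} {ε : ℝ} (h : ∀ᶠ k in l, (A k).Pairwise fun x y => ε ≤ dist x y) :
    (limitSet l A).Pairwise fun x y => ε ≤ dist x y := by
  rintro x ⟨f, hf, hx⟩ y ⟨g, hg, hy⟩ hxy
  refine ge_of_tendsto (hx.dist hy) ?_
  have hpos := (hx.dist hy).eventually (lt_mem_nhds (dist_pos.2 hxy))
  filter_upwards [h, hf, hg, hpos] with k hk hfk hgk hne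
  exact hk hfk hgk (dist_pos.1 hne)

theorem exists_mem_limitSet_dist_le {ι X : Type*} [PseudoMetricSpace X] [ProperSpace X]
    (u : Ultrafilter ι) {A : ι → Set X} {r : ℝ} {x : X}
    (h : ∀ᶠ k in (u : Filter ι), ∃ a ∈ A k, dist x a ≤ r) :
    ∃ a ∈ limitSet (u : Filter ι) A, dist x a ≤ r := by
  obtain ⟨f, hf⟩ := h.choice
  have hball : ∀ᶠ k in (u : Filter ι), f k ∈ Metric.closedBall x r :=
    hf.mono fun k hk => Metric.mem_closedBall'.2 hk.2
  obtain ⟨a, ha, hlim⟩ := (isCompact_closedBall x r).ultrafilter_le_nhds (u.map f)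
    (le_principal_iff.2 hball)
  exact ⟨a, ⟨f, hf.mono fun k hk => hk.1, hlim⟩, Metric.mem_closedBall'.1 ha⟩


/-- For every nonempty closed subset `S` of `ℝⁿ` (with the uniform norm) there exists a
decreasing sequence `(T i)_{i ∈ ℤ}` of nonempty closed subsets of `S` such that for every `i`
the points of `T i` are `2^i`-separated and `T i` is a `2^(i+1)`-net in `S`. -/
theorem stmt0 (n : ℕ) (S : Set (Fin n → ℝ)) (hne : S.Nonempty) (hcl : IsClosed S) :
    ∃ T : ℤ → Set (Fin n → ℝ),
      (∀ i : ℤ, (T i).Nonempty) ∧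
      (∀ i : ℤ, IsClosed (T i)) ∧
      (∀ i : ℤ, T i ⊆ S) ∧
      (∀ i : ℤ, T (i + 1) ⊆ T i) ∧
      (∀ i : ℤ, ∀ x ∈ T i, ∀ y ∈ T i, x ≠ y → (2 : ℝ) ^ i ≤ ‖x - y‖) ∧
      (∀ i : ℤ, ∀ x ∈ S, ∃ a ∈ T i, ‖x - a‖ ≤ (2 : ℝ) ^ (i + 1)) := by
  choose A hAS hmono hsep hnet using fun N : ℕ => exists_nested_dyadic_nets_from S (-(N : ℤ))
  let u : Ultrafilter ℕ := hyperfilter ℕ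
  have hlarge : ∀ i : ℤ, ∀ᶠ N : ℕ in (u : Filter ℕ), -(N : ℤ) ≤ i := fun i =>
    Nat.hyperfilter_le_atTop <| (eventually_ge_atTop (-i).toNat).mono fun N hN => by omega
  have hTsep : ∀ i : ℤ, (limitSet (u : Filter ℕ) fun N => A N i).Pairwise
      fun x y => (2 : ℝ) ^ i ≤ dist x y := fun i =>
    pairwise_le_dist_limitSet ((hlarge i).mono fun N hN => hsep N i hN)
  have hTnet : ∀ i : ℤ, ∀ x ∈ S, ∃ a ∈ limitSet (u : Filter ℕ) fun N => A N i,
      dist x a ≤ (2 : ℝ) ^ (i + 1) := fun i x hx =>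
    exists_mem_limitSet_dist_le u ((hlarge i).mono fun N hN => hnet N i hN x hx)
  refine ⟨fun i => limitSet (u : Filter ℕ) fun N => A N i, fun i => ?_, fun i => ?_, fun i => ?_,
    fun i => ?_, fun i x hx y hy hxy => ?_, fun i x hx => ?_⟩
  · obtain ⟨x, hx⟩ := hne
    obtain ⟨a, ha, -⟩ := hTnet i x hx
    exact ⟨a, ha⟩
  · exact Metric.isClosed_of_pairwise_le_dist (zpow_pos two_pos i) (hTsep i)
  · exact limitSet_subset_of_isClosed hcl (Eventually.of_forall fun N => hAS N i)
  · exact limitSet_mono ((hlarge i).mono fun N hN => hmono N i hN)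
  · rw [← dist_eq_norm]
    exact hTsep i hx hy hxy
  · simpa only [dist_eq_norm] using hTnet i x hx
end

section
/- Let S be a nonempty closed subset of ℝⁿ and let 𝒬 be a family of pairwise non-overlapping cubes in ℝⁿ. Suppose there exist constants η, θ ≥ 1 such that diam Q ≤ η·diam((θQ) ∩ S) for every cube Q ∈ 𝒬. Then there exists a mapping Q ↦ w_Q from 𝒬 to S such that: (i) w_Q ∈ (2θ)Q ∩ S for every Q ∈ 𝒬; and (ii) for every a ∈ S, the number of cubes Q ∈ 𝒬 with w_Q = a is at most γ, where γ is a constant depending only on n, η and θ. -/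
/-- A finite set `V` of diameter at most `T` carries a ranking `d` such that, at each scale
`t ≤ T`, the points of rank at least `t` form a `t`-net of `V`, while two distinct points are at
distance at least the smaller of their ranks. This lemma extends such a ranking from `A ⊆ V`,
where it is a net at scales `t ≥ δ`, to all of `V` by farthest-point insertion. -/
theorem exists_net_ranking_extend {X : Type*} [PseudoMetricSpace X] (V : Finset X) (T : ℝ)
    (k : ℕ) (A : Finset X) (hAV : A ⊆ V) (hA : A.Nonempty) (hk : V.card = A.card + k)
    (d : X → ℝ) (δ : ℝ) (hδT : δ ≤ T) (hδ : ∀ u ∈ A, δ ≤ d u)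
    (hsep : ∀ u ∈ A, ∀ v ∈ A, u ≠ v → min (d u) (d v) ≤ dist u v)
    (hcov : ∀ x ∈ V, ∀ t, δ ≤ t → t ≤ T → ∃ u ∈ A, t ≤ d u ∧ dist x u ≤ t) :
    ∃ d' : X → ℝ, (∀ u ∈ V, ∀ v ∈ V, u ≠ v → min (d' u) (d' v) ≤ dist u v) ∧
      ∀ x ∈ V, ∀ t, 0 ≤ t → t ≤ T → ∃ u ∈ V, t ≤ d' u ∧ dist x u ≤ t := by
  classical
  induction k generalizing A d δ with
  | zero =>
    obtain rfl : A = V := Finset.eq_of_subset_of_card_le hAV (by omega)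
    refine ⟨d, hsep, fun x hx t ht htT => ?_⟩
    rcases le_total δ t with h | h
    · exact hcov x hx t h htT
    · exact ⟨x, hx, h.trans (hδ x hx), by simpa using ht⟩
  | succ k ih =>
    have hne : (V \ A).Nonempty := by
      rw [← Finset.card_pos, Finset.card_sdiff_of_subset hAV]
      omega
    obtain ⟨p, hp, hpmax⟩ :=
      Finset.exists_max_image (V \ A) (fun x => A.inf' hA (fun u => dist x u)) hne
    obtain ⟨hpV, hpA⟩ := Finset.mem_sdiff.1 hp
    set ε := A.inf' hA (fun u => dist p u)
    have hεu : ∀ u ∈ A, ε ≤ dist p u := fun u hu => Finset.inf'_le _ hu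
    have hεδ : ε ≤ δ := by
      obtain ⟨u, hu, -, h⟩ := hcov p hpV δ le_rfl hδT
      exact (hεu u hu).trans h
    have hε0 : 0 ≤ ε := (Finset.le_inf'_iff _ _).2 fun _ _ => dist_nonneg
    have hup : ∀ u ∈ A, Function.update d p ε u = d u := fun u hu =>
      Function.update_of_ne (fun h : u = p => hpA (h ▸ hu)) _ _
    refine ih (insert p A) (Finset.insert_subset hpV hAV) (Finset.insert_nonempty _ _)
      (by rw [Finset.card_insert_of_notMem hpA]; omega) (Function.update d p ε) ε
      (hεδ.trans hδT) ?_ ?_ ?_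
    · intro u hu
      rcases Finset.mem_insert.1 hu with rfl | hu
      · simp
      · rw [hup u hu]
        exact hεδ.trans (hδ u hu)
    · intro u hu v hv huv
      rcases Finset.mem_insert.1 hu with rfl | huA <;>
        rcases Finset.mem_insert.1 hv with rfl | hvA
      · exact absurd rfl huv
      · exact (min_le_left _ _).trans (by simpa using hεu v hvA)
      · exact (min_le_right _ _).trans (by simpa [dist_comm] using hεu u huA)
      · rw [hup u huA, hup v hvA]
        exact hsep u huA v hvA huv
    · intro x hx t ht htT
      suffices ∃ u ∈ A, t ≤ d u ∧ dist x u ≤ t by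
        obtain ⟨u, hu, h⟩ := this
        exact ⟨u, Finset.mem_insert_of_mem hu, by rwa [hup u hu]⟩
      rcases le_total δ t with h | h
      · exact hcov x hx t h htT
      · by_cases hxA : x ∈ A
        · exact ⟨x, hxA, h.trans (hδ x hxA), by simpa using hε0.trans ht⟩
        · obtain ⟨u, hu, hxu⟩ := Finset.exists_mem_eq_inf' hA (fun u => dist x u)
          refine ⟨u, hu, h.trans (hδ u hu), ?_⟩
          rw [← hxu]
          exact (hpmax x (Finset.mem_sdiff.2 ⟨hx, hxA⟩)).trans ht

theorem exists_net_ranking {X : Type*} [PseudoMetricSpace X] (V : Finset X) :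
    ∃ d : X → ℝ, (∀ u ∈ V, ∀ v ∈ V, u ≠ v → min (d u) (d v) ≤ dist u v) ∧
      ∀ x ∈ V, ∀ t, 0 ≤ t → t ≤ Metric.diam (V : Set X) →
        ∃ u ∈ V, t ≤ d u ∧ dist x u ≤ t := by
  rcases V.eq_empty_or_nonempty with rfl | ⟨a, ha⟩
  · exact ⟨0, by simp, by simp⟩
  have hcard := Finset.card_pos.2 ⟨a, ha⟩
  refine exists_net_ranking_extend V _ (V.card - 1) {a} (by simpa) (by simp)
    (by simp; omega) (fun _ => Metric.diam (V : Set X)) _ le_rfl (by simp) ?_ ?_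
  · simp +contextual
  · intro x hx t ht htT
    exact ⟨a, by simp, htT, (Metric.dist_le_diam_of_mem V.finite_toSet.isBounded hx ha).trans ht⟩

/-- A pair of points `x`, `y` of a ranked finite set is approximated by a point whose rank is
comparable to `dist x y`. -/
theorem exists_mem_rank_comparable {X : Type*} [PseudoMetricSpace X] {V : Finset X} {d : X → ℝ}
    (hsep : ∀ u ∈ V, ∀ v ∈ V, u ≠ v → min (d u) (d v) ≤ dist u v)
    (hcov : ∀ x ∈ V, ∀ t, 0 ≤ t → t ≤ Metric.diam (V : Set X) →
      ∃ u ∈ V, t ≤ d u ∧ dist x u ≤ t)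
    {x y : X} (hx : x ∈ V) (hy : y ∈ V) (hxy : 0 < dist x y) :
    ∃ w ∈ V, dist x y / 4 ≤ d w ∧ d w ≤ 3 / 2 * dist x y ∧
      (dist x w ≤ dist x y / 4 ∨ dist y w ≤ dist x y / 4) := by
  have hdiam : dist x y / 4 ≤ Metric.diam (V : Set X) :=
    le_trans (by linarith) (Metric.dist_le_diam_of_mem V.finite_toSet.isBounded hx hy)
  obtain ⟨u, hu, hdu, hxu⟩ := hcov x hx _ (by positivity) hdiam
  obtain ⟨v, hv, hdv, hyv⟩ := hcov y hy _ (by positivity) hdiam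
  have huv : u ≠ v := by
    rintro rfl
    linarith [dist_triangle_right x y u]
  have huv' : dist u v ≤ 3 / 2 * dist x y := by
    linarith [dist_triangle4 u x y v, dist_comm u x]
  rcases min_le_iff.1 (hsep u hu v hv huv) with h | h
  · exact ⟨u, hu, hdu, h.trans huv', Or.inl hxu⟩
  · exact ⟨v, hv, hdv, h.trans huv', Or.inr hyv⟩

theorem exists_card_le_of_separated (E : Type*) [NormedAddCommGroup E] [NormedSpace ℝ E]
    [FiniteDimensional ℝ E] (K : ℝ) :
    ∃ N : ℕ, ∀ {ι : Type*} (s : Finset ι) (f : ι → E) (a : E) (ρ : ℝ), 0 < ρ →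
      (∀ i ∈ s, dist (f i) a ≤ K * ρ) →
      (∀ i ∈ s, ∀ j ∈ s, i ≠ j → ρ ≤ dist (f i) (f j)) → s.card ≤ N := by
  have : ProperSpace E := FiniteDimensional.proper ℝ E
  obtain ⟨t, -, ht, hcov⟩ :=
    (isCompact_closedBall (0 : E) K).finite_cover_balls (e := 1 / 2) (by norm_num)
  refine ⟨ht.toFinset.card, fun s f a ρ hρ hK hsep => ?_⟩
  have hmem : ∀ i ∈ s, ∃ y ∈ t, dist (ρ⁻¹ • (f i - a)) y < 1 / 2 := by
    intro i hi
    have : ρ⁻¹ • (f i - a) ∈ Metric.closedBall (0 : E) K := by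
      rw [mem_closedBall_zero_iff, norm_smul, ← dist_eq_norm, Real.norm_of_nonneg (by positivity),
        inv_mul_le_iff₀ hρ, mul_comm]
      exact hK i hi
    simpa using hcov this
  choose! y hyt hy using hmem
  refine Finset.card_le_card_of_injOn y (fun i hi => by simpa using hyt i hi) ?_
  intro i hi j hj hij
  by_contra hne
  have h1 : dist (ρ⁻¹ • (f i - a)) (ρ⁻¹ • (f j - a)) < 1 := by
    have h2 := hy i hi
    have h3 := hy j hj
    rw [← hij] at h3
    linarith [dist_triangle_right (ρ⁻¹ • (f i - a)) (ρ⁻¹ • (f j - a)) (y i)]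
  rw [dist_smul₀, dist_sub_right, Real.norm_of_nonneg (by positivity), inv_mul_lt_iff₀ hρ,
    mul_one] at h1
  exact absurd (hsep i hi j hj hne) (not_le.2 h1)

/-- Finitely many non-overlapping balls, each carrying two points `x`, `y` of its `θ`-dilate at
distance comparable to the radius, number at most a constant times the number of these points. -/
theorem exists_card_le_mul_card_endpoints (E : Type*) [NormedAddCommGroup E] [NormedSpace ℝ E]
    [FiniteDimensional ℝ E] [DecidableEq E] (η θ : ℝ) (hη : 1 ≤ η) (hθ : 1 ≤ θ) :
    ∃ N : ℕ, ∀ {ι : Type*} (s : Finset ι) (c : ι → E) (r : ι → ℝ) (x y : ι → E),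
      (∀ i ∈ s, 0 < r i) →
      (∀ i ∈ s, ∀ j ∈ s, i ≠ j → min (r i) (r j) ≤ dist (c i) (c j)) →
      (∀ i ∈ s, dist (x i) (c i) ≤ θ * r i) → (∀ i ∈ s, dist (y i) (c i) ≤ θ * r i) →
      (∀ i ∈ s, r i ≤ η * dist (x i) (y i)) →
      s.card ≤ N * (s.biUnion fun i => {x i, y i}).card := by
  obtain ⟨N, hN⟩ := exists_card_le_of_separated E (24 * η * θ ^ 2)
  refine ⟨N, fun s c r x y hr hsep hx hy hxy => ?_⟩
  obtain ⟨d, hdsep, hdcov⟩ := exists_net_ranking (s.biUnion fun i => {x i, y i})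
  set V := s.biUnion fun i => ({x i, y i} : Finset E)
  have hpos : ∀ i ∈ s, 0 < dist (x i) (y i) := fun i hi =>
    pos_of_mul_pos_right ((hr i hi).trans_le (hxy i hi)) (by linarith)
  have hw : ∀ i ∈ s, ∃ w ∈ V, dist (x i) (y i) / 4 ≤ d w ∧ d w ≤ 3 / 2 * dist (x i) (y i) ∧
      (dist (x i) w ≤ dist (x i) (y i) / 4 ∨ dist (y i) w ≤ dist (x i) (y i) / 4) := fun i hi =>
    exists_mem_rank_comparable hdsep hdcov (Finset.mem_biUnion.2 ⟨i, hi, by simp⟩)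
      (Finset.mem_biUnion.2 ⟨i, hi, by simp⟩) (hpos i hi)
  choose! w hwV hdw hwd hwxy using hw
  refine Finset.card_le_mul_card_image_of_maps_to hwV N fun v _ => ?_
  rcases (s.filter fun i => w i = v).eq_empty_or_nonempty with h | ⟨i₀, hi₀⟩
  · simp [h]
  have hdv : 0 < d v := by
    obtain ⟨hi, rfl⟩ := Finset.mem_filter.1 hi₀
    linarith [hpos i₀ hi, hdw i₀ hi]
  have hdiam : ∀ i ∈ s, dist (x i) (y i) ≤ 2 * (θ * r i) := fun i hi => by
    linarith [dist_triangle_right (x i) (y i) (c i), hx i hi, hy i hi]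
  have hρ : ∀ i ∈ s, w i = v → d v / (3 * θ) ≤ r i := by
    rintro i hi rfl
    rw [div_le_iff₀ (by linarith)]
    linarith [hwd i hi, hdiam i hi, hpos i hi]
  refine hN _ c v (d v / (3 * θ)) (by positivity) ?_ ?_
  · intro i hiv
    obtain ⟨hi, rfl⟩ := Finset.mem_filter.1 hiv
    have h1 : dist (c i) (w i) ≤ 2 * (θ * r i) := by
      rcases hwxy i hi with h | h
      · linarith [dist_triangle_left (c i) (w i) (x i), hx i hi, hdiam i hi, hpos i hi]
      · linarith [dist_triangle_left (c i) (w i) (y i), hy i hi, hdiam i hi, hpos i hi]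
    have h2 : r i ≤ η * (4 * d (w i)) :=
      (hxy i hi).trans (mul_le_mul_of_nonneg_left (by linarith [hdw i hi]) (by linarith))
    calc dist (c i) (w i) ≤ 2 * (θ * r i) := h1
      _ ≤ 2 * (θ * (η * (4 * d (w i)))) := by gcongr
      _ = 24 * η * θ ^ 2 * (d (w i) / (3 * θ)) := by field_simp; ring
  · intro i hi j hj hij
    obtain ⟨hi, hwi⟩ := Finset.mem_filter.1 hi
    obtain ⟨hj, hwj⟩ := Finset.mem_filter.1 hj
    exact (le_min (hρ i hi hwi) (hρ j hj hwj)).trans (hsep i hi j hj hij)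

/-- Two non-overlapping closed balls have centers at distance at least the smaller radius. -/
theorem min_le_dist_of_disjoint_interior_closedBall {X : Type*} [PseudoMetricSpace X]
    {c c' : X} {r r' : ℝ} (hr : 0 < r)
    (h : Disjoint (interior (Metric.closedBall c r)) (interior (Metric.closedBall c' r'))) :
    min r r' ≤ dist c c' := by
  by_contra! hlt
  obtain ⟨-, h2⟩ := lt_min_iff.1 hlt
  exact Set.disjoint_left.1 h (Metric.ball_subset_interior_closedBall (Metric.mem_ball_self hr))
    (Metric.ball_subset_interior_closedBall (Metric.mem_ball.2 h2))

theorem two_mul_le_diam_closedBall {n : ℕ} [NeZero n] (c : Fin n → ℝ) {r : ℝ} (hr : 0 < r) :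
    2 * r ≤ Metric.diam (Metric.closedBall c r) := by
  have h1 : c + (fun _ => r) ∈ Metric.closedBall c r := by
    simp [pi_norm_const, abs_of_pos hr]
  calc 2 * r = dist (c + fun _ => r) (c - fun _ => r) := by
        have : (c + fun _ => r) - (c - fun _ => r) = fun _ => 2 * r := by
          ext i
          simp
          ring
        rw [dist_eq_norm, this, pi_norm_const, Real.norm_of_nonneg (by positivity)]
    _ ≤ _ := Metric.dist_le_diam_of_mem Metric.isBounded_closedBall h1
        (by simp [pi_norm_const, abs_of_pos hr])

theorem Metric.exists_lt_dist_of_lt_diam {X : Type*} [PseudoMetricSpace X] {s : Set X} {t : ℝ}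
    (ht : 0 ≤ t) (h : t < Metric.diam s) : ∃ x ∈ s, ∃ y ∈ s, t < dist x y := by
  by_contra! hle
  exact absurd (Metric.diam_le_of_forall_dist_le ht hle) (not_le.2 h)

/-- Hall's marriage theorem with multiplicity. -/
theorem exists_choice_fiber_card_le {ι α : Type*} [DecidableEq α] (t : ι → Finset α) (N : ℕ)
    (h : ∀ s : Finset ι, s.card ≤ N * (s.biUnion t).card) :
    ∃ f : ι → α, (∀ i, f i ∈ t i) ∧ ∀ a, Finite {i // f i = a} ∧ Nat.card {i // f i = a} ≤ N := by
  obtain ⟨g, hg, hgt⟩ := (Finset.all_card_le_biUnion_card_iff_exists_injective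
    (fun i => t i ×ˢ (Finset.univ : Finset (Fin N)))).1 (fun s => by
      have : s.biUnion (fun i => t i ×ˢ (Finset.univ : Finset (Fin N))) =
          s.biUnion t ×ˢ Finset.univ := by
        ext
        simp
      rw [this, Finset.card_product, Finset.card_fin, mul_comm]
      exact h s)
  refine ⟨fun i => (g i).1, fun i => (Finset.mem_product.1 (hgt i)).1, fun a => ?_⟩
  have hinj : Function.Injective fun i : {i // (g i).1 = a} => (g i).2 := fun i j hij =>
    Subtype.ext (hg (Prod.ext (i.2.trans j.2.symm) hij))
  exact ⟨Finite.of_injective _ hinj, by simpa using Nat.card_le_card_of_injective _ hinj⟩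

/-- Shvartsman, Proposition 4.3 ("WN"): given a family `𝒬` of pairwise non-overlapping cubes
in `ℝⁿ` (uniform norm) satisfying `diam Q ≤ η · diam((θQ) ∩ S)`, there is a mapping
`Q ↦ w_Q ∈ (2θ)Q ∩ S` such that every point `a ∈ S` is the image of at most `γ = γ(n, η, θ)`
cubes. A cube `Q(c,r)` is encoded by the pair `(c, r)` and is the closed ball of center `c`
and radius `r` in the uniform norm. -/
theorem stmt1 (n : ℕ) (η θ : ℝ) (hη : 1 ≤ η) (hθ : 1 ≤ θ) :
    ∃ γ : ℕ,
      ∀ (S : Set (Fin n → ℝ)), S.Nonempty → IsClosed S →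
      ∀ 𝒬 : Set ((Fin n → ℝ) × ℝ),
        (∀ Q ∈ 𝒬, 0 < Q.2) →
        (∀ Q ∈ 𝒬, ∀ Q' ∈ 𝒬, Q ≠ Q' →
          Disjoint (interior (Metric.closedBall Q.1 Q.2))
            (interior (Metric.closedBall Q'.1 Q'.2))) →
        (∀ Q ∈ 𝒬, Metric.diam (Metric.closedBall Q.1 Q.2) ≤
            η * Metric.diam (Metric.closedBall Q.1 (θ * Q.2) ∩ S)) →
        ∃ w : (Fin n → ℝ) × ℝ → (Fin n → ℝ),
          (∀ Q ∈ 𝒬, w Q ∈ Metric.closedBall Q.1 (2 * θ * Q.2) ∩ S) ∧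
          (∀ a ∈ S, {Q ∈ 𝒬 | w Q = a}.Finite ∧ {Q ∈ 𝒬 | w Q = a}.ncard ≤ γ) := by
  classical
  rcases n.eq_zero_or_pos with rfl | hn
  · refine ⟨1, fun S hS _ 𝒬 hr hdisj _ => ?_⟩
    obtain ⟨p, hp⟩ := hS
    have h𝒬 : 𝒬.Subsingleton := fun Q hQ Q' hQ' => by
      by_contra hne
      have := min_le_dist_of_disjoint_interior_closedBall (hr Q hQ) (hdisj Q hQ Q' hQ' hne)
      rw [Subsingleton.elim Q.1 Q'.1, dist_self] at this
      exact absurd this (not_le.2 (lt_min (hr Q hQ) (hr Q' hQ')))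
    refine ⟨fun _ => p, fun Q hQ => ⟨?_, hp⟩, fun a _ => ?_⟩
    · have := hr Q hQ
      rw [Subsingleton.elim p Q.1]
      exact Metric.mem_closedBall_self (by positivity)
    · have hsub : {Q ∈ 𝒬 | p = a}.Subsingleton := h𝒬.anti (Set.sep_subset _ _)
      exact ⟨hsub.finite, (Set.ncard_le_one hsub.finite).2 fun x hx y hy => hsub hx hy⟩
  have : NeZero n := ⟨hn.ne'⟩
  obtain ⟨N, hN⟩ := exists_card_le_mul_card_endpoints (Fin n → ℝ) η θ hη hθ
  refine ⟨N, fun S _ _ 𝒬 hr hdisj hdiam => ?_⟩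
  have hpair : ∀ Q : 𝒬, ∃ x y, x ∈ Metric.closedBall Q.1.1 (θ * Q.1.2) ∩ S ∧
      y ∈ Metric.closedBall Q.1.1 (θ * Q.1.2) ∩ S ∧ Q.1.2 ≤ η * dist x y := by
    rintro ⟨Q, hQ⟩
    have hη0 : 0 < η := by linarith
    have hrQ := hr Q hQ
    have hlt : Q.2 / η < Metric.diam (Metric.closedBall Q.1 (θ * Q.2) ∩ S) := by
      rw [div_lt_iff₀' hη0]
      linarith [two_mul_le_diam_closedBall Q.1 hrQ, hdiam Q hQ]
    obtain ⟨x, hx, y, hy, hxy⟩ := Metric.exists_lt_dist_of_lt_diam (by positivity) hlt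
    exact ⟨x, y, hx, hy, ((div_lt_iff₀' hη0).1 hxy).le⟩
  choose x y hx hy hxy using hpair
  obtain ⟨f, hf, hcard⟩ := exists_choice_fiber_card_le (fun Q : 𝒬 => {x Q, y Q}) N fun s =>
    hN s (fun Q => Q.1.1) (fun Q => Q.1.2) x y (fun Q _ => hr Q Q.2)
      (fun Q _ Q' _ hne => min_le_dist_of_disjoint_interior_closedBall (hr Q Q.2)
        (hdisj Q Q.2 Q' Q'.2 fun h => hne (Subtype.ext h)))
      (fun Q _ => (hx Q).1) (fun Q _ => (hy Q).1) (fun Q _ => hxy Q)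
  refine ⟨fun Q => if h : Q ∈ 𝒬 then f ⟨Q, h⟩ else 0, fun Q hQ => ?_, fun a _ => ?_⟩
  · have hrQ := hr Q hQ
    have hmem : f ⟨Q, hQ⟩ ∈ Metric.closedBall Q.1 (θ * Q.2) ∩ S := by
      rcases Finset.mem_insert.1 (hf ⟨Q, hQ⟩) with h | h
      · exact h ▸ hx ⟨Q, hQ⟩
      · exact Finset.mem_singleton.1 h ▸ hy ⟨Q, hQ⟩
    simp only [hQ, dite_true]
    exact ⟨Metric.closedBall_subset_closedBall (by nlinarith) hmem.1, hmem.2⟩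
  · have himg : {Q ∈ 𝒬 | (if h : Q ∈ 𝒬 then f ⟨Q, h⟩ else 0) = a} =
        Subtype.val '' {Q : 𝒬 | f Q = a} := by
      ext Q
      by_cases hQ : Q ∈ 𝒬 <;> simp [hQ]
    rw [himg, Set.ncard_image_of_injective _ Subtype.val_injective]
    exact ⟨(Set.finite_coe_iff.1 (hcard a).1).image _, (hcard a).2⟩
end

section
/- Let V be a nonempty set such that the true lacuna L = L(V) = {Q ∈ W_E : (10Q) ∩ E = (90Q) ∩ E = V} is nonempty. Then (1/90)·diam V ≤ inf{diam Q : Q ∈ L} ≤ γ·diam V, where γ is an absolute constant. -/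
open scoped ENNReal

noncomputable section

/-- The cube `Q(c,r)` in `ℝⁿ` with the uniform norm: the closed ball of center `c = Q.1` and
radius `r = Q.2`.  A cube is encoded by the pair `Q = (c, r)`. -/
def cube {n : ℕ} (Q : (Fin n → ℝ) × ℝ) : Set (Fin n → ℝ) :=
  Metric.closedBall Q.1 Q.2

/-- The dilation `λQ = Q(c, λr)` of the cube `Q = (c, r)`. -/
def dilate {n : ℕ} (l : ℝ) (Q : (Fin n → ℝ) × ℝ) : Set (Fin n → ℝ) :=
  Metric.closedBall Q.1 (l * Q.2)

/-- Extended distance between two sets: `dist(A, B) = inf {‖a - b‖ : a ∈ A, b ∈ B}`, with the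
convention that it equals `+∞` if one of the sets is empty. -/
def eSetDist {n : ℕ} (A B : Set (Fin n → ℝ)) : ℝ≥0∞ :=
  ⨅ a ∈ A, ⨅ b ∈ B, edist a b

/-- `W` is a Whitney covering of `ℝⁿ ∖ E`: a countable family of pairwise non-overlapping
cubes whose union is `ℝⁿ ∖ E` and such that `diam Q ≤ dist(Q, E) ≤ 4 diam Q` for all
`Q ∈ W`. -/
structure IsWhitney {n : ℕ} (E : Set (Fin n → ℝ)) (W : Set ((Fin n → ℝ) × ℝ)) : Prop where
  countable : W.Countable
  radius_pos : ∀ Q ∈ W, 0 < Q.2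
  nonoverlap : ∀ Q ∈ W, ∀ Q' ∈ W, Q ≠ Q' →
    Disjoint (interior (cube Q)) (interior (cube Q'))
  union_eq : (⋃ Q ∈ W, cube Q) = Eᶜ
  diam_le_dist : ∀ Q ∈ W, EMetric.diam (cube Q) ≤ eSetDist (cube Q) E
  dist_le_diam : ∀ Q ∈ W, eSetDist (cube Q) E ≤ 4 * EMetric.diam (cube Q)

/-- The true lacuna associated with a set `V`:
`L(V) = {Q ∈ W : (10Q) ∩ E = (90Q) ∩ E = V}`. -/
def lacuna {n : ℕ} (E : Set (Fin n → ℝ)) (W : Set ((Fin n → ℝ) × ℝ))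
    (V : Set (Fin n → ℝ)) : Set ((Fin n → ℝ) × ℝ) :=
  {Q ∈ W | dilate 10 Q ∩ E = V ∧ dilate 90 Q ∩ E = V}

theorem ediam_cube {n : ℕ} (hn : 0 < n) (Q : (Fin n → ℝ) × ℝ) (hQ : 0 < Q.2) :
    Metric.ediam (cube Q) = ENNReal.ofReal (2 * Q.2) := by
  have : Nonempty (Fin n) := ⟨⟨0, hn⟩⟩
  apply le_antisymm
  · refine Metric.ediam_le fun x hx y hy => ?_
    rw [edist_dist]
    apply ENNReal.ofReal_le_ofReal
    have hx' : dist x Q.1 ≤ Q.2 := hx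
    have hy' : dist y Q.1 ≤ Q.2 := hy
    linarith [dist_triangle_right x y Q.1]
  · have h1 : Q.1 + (fun _ => Q.2) ∈ cube Q := by
      simp [cube, Metric.mem_closedBall, dist_eq_norm, pi_norm_const, abs_of_pos hQ]
    have h2 : Q.1 - (fun _ => Q.2) ∈ cube Q := by
      simp [cube, Metric.mem_closedBall, pi_norm_const, abs_of_pos hQ]
    refine le_trans (le_of_eq ?_) (Metric.edist_le_ediam_of_mem h1 h2)
    rw [edist_dist, dist_eq_norm]
    have : Q.1 + (fun _ => Q.2) - (Q.1 - fun _ => Q.2) = fun _ => 2 * Q.2 := by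
      ext i
      simp only [Pi.add_apply, Pi.sub_apply]
      ring
    rw [this, pi_norm_const, Real.norm_of_nonneg (by positivity)]

/-- A cube of a Whitney covering of a nonempty set forces the dimension to be positive. -/
theorem IsWhitney.dim_pos {n : ℕ} {E : Set (Fin n → ℝ)} {W : Set ((Fin n → ℝ) × ℝ)}
    (hW : IsWhitney E W) (hE : E.Nonempty) {Q : (Fin n → ℝ) × ℝ} (hQ : Q ∈ W) : 0 < n := by
  rcases Nat.eq_zero_or_pos n with rfl | h
  · obtain ⟨e, he⟩ := hE
    have hc : Q.1 ∈ ⋃ Q ∈ W, cube Q :=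
      Set.mem_biUnion hQ (Metric.mem_closedBall_self (hW.radius_pos Q hQ).le)
    rw [hW.union_eq] at hc
    exact absurd (Subsingleton.elim e Q.1 ▸ he) hc
  · exact h

theorem IsWhitney.two_mul_radius_le_dist {n : ℕ} {E : Set (Fin n → ℝ)}
    {W : Set ((Fin n → ℝ) × ℝ)} (hW : IsWhitney E W) (hn : 0 < n)
    {Q : (Fin n → ℝ) × ℝ} (hQ : Q ∈ W) {x v : Fin n → ℝ} (hx : x ∈ cube Q) (hv : v ∈ E) :
    2 * Q.2 ≤ dist x v := by
  have h : Metric.ediam (cube Q) ≤ edist x v :=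
    (hW.diam_le_dist Q hQ).trans ((iInf₂_le x hx).trans (iInf₂_le v hv))
  rw [ediam_cube hn Q (hW.radius_pos Q hQ), edist_dist] at h
  exact (ENNReal.ofReal_le_ofReal_iff dist_nonneg).1 h

theorem IsWhitney.exists_dist_center_le {n : ℕ} {E : Set (Fin n → ℝ)}
    {W : Set ((Fin n → ℝ) × ℝ)} (hW : IsWhitney E W) (hn : 0 < n)
    {Q : (Fin n → ℝ) × ℝ} (hQ : Q ∈ W) : ∃ e ∈ E, dist e Q.1 ≤ 19 / 2 * Q.2 := by
  have hr := hW.radius_pos Q hQ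
  have h : eSetDist (cube Q) E ≤ 4 * Metric.ediam (cube Q) := hW.dist_le_diam Q hQ
  rw [ediam_cube hn Q hr] at h
  have h' : eSetDist (cube Q) E < ENNReal.ofReal (17 / 2 * Q.2) := by
    refine h.trans_lt ?_
    rw [show (4 : ℝ≥0∞) = ENNReal.ofReal 4 by simp, ← ENNReal.ofReal_mul (by norm_num),
      ENNReal.ofReal_lt_ofReal_iff (by positivity)]
    linarith
  simp only [eSetDist, iInf_lt_iff] at h'
  obtain ⟨a, ha, e, he, hae⟩ := h'
  rw [edist_dist, ENNReal.ofReal_lt_ofReal_iff (by positivity)] at hae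
  have ha' : dist a Q.1 ≤ Q.2 := ha
  exact ⟨e, he, by linarith [dist_triangle_left e Q.1 a]⟩

theorem exists_mem_lacuna_radius_le {n : ℕ} {E V : Set (Fin n → ℝ)}
    {W : Set ((Fin n → ℝ) × ℝ)} (hW : IsWhitney E W) (hn : 0 < n) (hV : V.Nonempty)
    (hL : (lacuna E W V).Nonempty) {ε : ℝ} (hε : 0 < ε)
    (hd : ∀ v ∈ V, ∀ w ∈ V, 40 * dist v w ≤ ε) : ∃ Q ∈ lacuna E W V, Q.2 ≤ ε := by
  obtain ⟨Q, hQ⟩ := hL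
  by_cases hbig : Q.2 ≤ ε
  · exact ⟨Q, hQ, hbig⟩
  push Not at hbig
  obtain ⟨hQW, h10, h90⟩ := hQ
  obtain ⟨v, hv⟩ := hV
  have mem_V : ∀ y ∈ E, dist y Q.1 ≤ 90 * Q.2 → y ∈ V := fun y hy h => h90 ▸ ⟨h, hy⟩
  have V_sub : V ⊆ E := fun y hy => (h10.symm ▸ hy : y ∈ dilate 10 Q ∩ E).2
  have hvQ : dist v Q.1 ≤ 10 * Q.2 := (h10.symm ▸ hv : v ∈ dilate 10 Q ∩ E).1
  have : Nonempty (Fin n) := ⟨⟨0, hn⟩⟩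
  obtain ⟨x, hx⟩ : ∃ x : Fin n → ℝ, dist x v = ε :=
    ⟨v + fun _ => ε, by simp [dist_eq_norm, pi_norm_const, abs_of_pos hε]⟩
  have hxE : x ∈ Eᶜ := fun h => by
    have := hd x (mem_V x h (by linarith [dist_triangle x v Q.1])) v hv
    linarith
  rw [← hW.union_eq, Set.mem_iUnion₂] at hxE
  obtain ⟨P, hP, hxP⟩ := hxE
  have hxP' : dist x P.1 ≤ P.2 := hxP
  have hPε : 2 * P.2 ≤ ε := hx ▸ hW.two_mul_radius_le_dist hn hP hxP (V_sub hv)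
  obtain ⟨e, he, heP⟩ := hW.exists_dist_center_le hn hP
  have hex : dist e x ≤ 21 / 2 * P.2 := by linarith [dist_triangle_right e x P.1]
  have heV : e ∈ V := mem_V e he (by
    linarith [dist_triangle e x Q.1, dist_triangle x v Q.1])
  have hPlow : 39 / 40 * ε ≤ 21 / 2 * P.2 := by
    linarith [hd e heV v hv, dist_triangle_left x v e]
  have hPr := hW.radius_pos P hP
  have sub10 : ∀ w ∈ V, dist w P.1 ≤ 10 * P.2 := fun w hw => by
    linarith [hd w hw e heV, dist_triangle w e P.1]
  have sub90 : ∀ w ∈ E, dist w P.1 ≤ 90 * P.2 → w ∈ V := fun w hw h => mem_V w hw (by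
    linarith [dist_triangle w P.1 Q.1, dist_triangle_left P.1 Q.1 x, dist_triangle x v Q.1])
  refine ⟨P, ⟨hP, ?_, ?_⟩, by linarith⟩
  · exact Set.Subset.antisymm
      (fun w hw => sub90 w hw.2 (le_trans (show dist w P.1 ≤ 10 * P.2 from hw.1) (by linarith)))
      fun w hw => ⟨sub10 w hw, V_sub hw⟩
  · exact Set.Subset.antisymm (fun w hw => sub90 w hw.2 hw.1)
      fun w hw => ⟨show dist w P.1 ≤ 90 * P.2 by linarith [sub10 w hw], V_sub hw⟩

theorem ediam_le_of_mem_lacuna {n : ℕ} {E V : Set (Fin n → ℝ)}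
    {W : Set ((Fin n → ℝ) × ℝ)} {Q : (Fin n → ℝ) × ℝ} (hQ : Q ∈ lacuna E W V) :
    Metric.ediam V ≤ ENNReal.ofReal (20 * Q.2) := by
  have hV : ∀ v ∈ V, dist v Q.1 ≤ 10 * Q.2 := fun v hv =>
    (hQ.2.1.symm ▸ hv : v ∈ dilate 10 Q ∩ E).1
  refine Metric.ediam_le fun x hx y hy => ?_
  rw [edist_dist]
  apply ENNReal.ofReal_le_ofReal
  linarith [dist_triangle_right x y Q.1, hV x hx, hV y hy]

/-- If the true lacuna `L = L(V)` of a nonempty set `V` is nonempty, then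
`(1/90)·diam V ≤ inf {diam Q : Q ∈ L} ≤ γ·diam V` for an absolute constant `γ`. -/
theorem stmt2 :
    ∃ γ : ℝ≥0∞, 0 < γ ∧ γ ≠ ⊤ ∧
      ∀ (n : ℕ) (E : Set (Fin n → ℝ)) (W : Set ((Fin n → ℝ) × ℝ)),
        E.Nonempty → IsClosed E → IsWhitney E W →
        ∀ V : Set (Fin n → ℝ), V.Nonempty → (lacuna E W V).Nonempty →
          EMetric.diam V / 90 ≤ (⨅ Q ∈ lacuna E W V, EMetric.diam (cube Q)) ∧
          (⨅ Q ∈ lacuna E W V, EMetric.diam (cube Q)) ≤ γ * EMetric.diam V := by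
  refine ⟨80, by norm_num, by norm_num, ?_⟩
  intro n E W hE _ hW V hV hL
  have hn : 0 < n := hW.dim_pos hE hL.some_mem.1
  refine ⟨le_iInf₂ fun Q hQ => ?_, ?_⟩
  · have hr := hW.radius_pos Q hQ.1
    change Metric.ediam V / 90 ≤ Metric.ediam (cube Q)
    rw [ediam_cube hn Q hr]
    refine ENNReal.div_le_of_le_mul ((ediam_le_of_mem_lacuna hQ).trans ?_)
    rw [show (90 : ℝ≥0∞) = ENNReal.ofReal 90 by simp, ← ENNReal.ofReal_mul (by positivity)]
    exact ENNReal.ofReal_le_ofReal (by linarith)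
  · change (⨅ Q ∈ lacuna E W V, Metric.ediam (cube Q)) ≤ 80 * Metric.ediam V
    have hfin : Metric.ediam V ≠ ⊤ :=
      ne_top_of_le_ne_top ENNReal.ofReal_ne_top (ediam_le_of_mem_lacuna hL.some_mem)
    refine ENNReal.le_of_forall_pos_le_add fun δ hδ _ => ?_
    have hδ' : (0 : ℝ) < δ := hδ
    have hd0 : 0 ≤ Metric.diam V := Metric.diam_nonneg
    obtain ⟨Q, hQ, hQr⟩ := exists_mem_lacuna_radius_le (ε := 40 * Metric.diam V + δ / 2)
      hW hn hV hL (by positivity) fun v hv w hw => by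
        linarith [Metric.dist_le_diam_of_mem' hfin hv hw]
    refine (iInf₂_le Q hQ).trans ?_
    rw [ediam_cube hn Q (hW.radius_pos Q hQ.1), ← ENNReal.ofReal_toReal hfin,
      show (80 : ℝ≥0∞) = ENNReal.ofReal 80 by simp, ← ENNReal.ofReal_mul (by norm_num),
      ← ENNReal.ofReal_coe_nnreal, ← ENNReal.ofReal_add (by positivity) hδ'.le]
    apply ENNReal.ofReal_le_ofReal
    change _ ≤ 80 * Metric.diam V + δ
    linarith
end
end

section
/- Let V be a nonempty set such that the true lacuna L = L(V) = {Q ∈ W_E : (10Q) ∩ E = (90Q) ∩ E = V} is nonempty, and let U_L = ⋃{Q : Q ∈ L} be the union of all cubes of L. Then sup{diam Q : Q ∈ L} ≤ diam U_L ≤ 30·sup{diam Q : Q ∈ L}, where both sides are interpreted as values in [0, +∞]. -/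
open scoped ENNReal

noncomputable section

/-- A cube is at least as wide as its radius. -/
theorem ofReal_radius_le_diam_cube {n : ℕ} [Nonempty (Fin n)] (Q : (Fin n → ℝ) × ℝ)
    (hQ : 0 ≤ Q.2) : ENNReal.ofReal Q.2 ≤ Metric.ediam (cube Q) := by
  have hd : dist (Q.1 + fun _ => Q.2) Q.1 = Q.2 := by
    rw [dist_eq_norm, add_sub_cancel_left, pi_norm_const, Real.norm_of_nonneg hQ]
  calc ENNReal.ofReal Q.2 = edist (Q.1 + fun _ => Q.2) Q.1 := by rw [edist_dist, hd]
    _ ≤ Metric.ediam (cube Q) :=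
      Metric.edist_le_ediam_of_mem (Metric.mem_closedBall.2 hd.le) (Metric.mem_closedBall_self hQ)

/-- A point of a cube and a point of its tenfold dilation are at most eleven radii apart. -/
theorem edist_le_of_mem_cube_of_mem_dilate {n : ℕ} {Q : (Fin n → ℝ) × ℝ} {x v : Fin n → ℝ}
    (hx : x ∈ cube Q) (hv : v ∈ dilate 10 Q) : edist x v ≤ 11 * ENNReal.ofReal Q.2 := by
  rw [cube, Metric.mem_closedBall] at hx
  rw [dilate, Metric.mem_closedBall] at hv
  have h : dist x v ≤ 11 * Q.2 := by linarith [dist_triangle_right x v Q.1]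
  calc edist x v = ENNReal.ofReal (dist x v) := edist_dist x v
    _ ≤ ENNReal.ofReal (11 * Q.2) := ENNReal.ofReal_le_ofReal h
    _ = 11 * ENNReal.ofReal Q.2 := by
      rw [ENNReal.ofReal_mul (by norm_num), ENNReal.ofReal_ofNat]

/-- If the true lacuna `L = L(V)` of a nonempty set `V` is nonempty and `U_L` denotes the
union of all its cubes, then `sup {diam Q : Q ∈ L} ≤ diam U_L ≤ 30·sup {diam Q : Q ∈ L}`,
both sides interpreted in `[0, ∞]`. -/
theorem stmt4 (n : ℕ) (E : Set (Fin n → ℝ)) (W : Set ((Fin n → ℝ) × ℝ))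
    (hE : E.Nonempty) (hEc : IsClosed E) (hW : IsWhitney E W)
    (V : Set (Fin n → ℝ)) (hV : V.Nonempty) (hL : (lacuna E W V).Nonempty) :
    (⨆ Q ∈ lacuna E W V, EMetric.diam (cube Q)) ≤
        EMetric.diam (⋃ Q ∈ lacuna E W V, cube Q) ∧
      EMetric.diam (⋃ Q ∈ lacuna E W V, cube Q) ≤
        30 * ⨆ Q ∈ lacuna E W V, EMetric.diam (cube Q) := by
  refine ⟨iSup₂_le fun Q hQ => Metric.ediam_mono (Set.subset_biUnion_of_mem hQ), ?_⟩
  obtain ⟨v, hv⟩ := hV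
  refine Metric.ediam_le fun x hx y hy => ?_
  rcases isEmpty_or_nonempty (Fin n) with _ | _
  · simp [Subsingleton.elim x y]
  set S := ⨆ Q ∈ lacuna E W V, EMetric.diam (cube Q)
  have key : ∀ z ∈ ⋃ Q ∈ lacuna E W V, cube Q, edist z v ≤ 11 * S := by
    intro z hz
    obtain ⟨Q, hQ, hzQ⟩ := Set.mem_iUnion₂.1 hz
    have hvQ : v ∈ dilate 10 Q := (hQ.2.1.symm ▸ hv : v ∈ dilate 10 Q ∩ E).1
    refine (edist_le_of_mem_cube_of_mem_dilate hzQ hvQ).trans ?_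
    gcongr
    exact (ofReal_radius_le_diam_cube Q (hW.radius_pos Q hQ.1).le).trans
      (le_iSup₂ (f := fun Q (_ : Q ∈ lacuna E W V) => EMetric.diam (cube Q)) Q hQ)
  calc edist x y ≤ edist x v + edist y v := edist_triangle_right x y v
    _ ≤ 11 * S + 11 * S := add_le_add (key x hx) (key y hy)
    _ = 22 * S := by ring
    _ ≤ 30 * S := by gcongr; norm_num
end
end

section
/- Let V be a nonempty set such that the true lacuna L = L(V) = {Q ∈ W_E : (10Q) ∩ E = (90Q) ∩ E = V} is nonempty, and let I_L = {K ∈ W_E : K ∉ L and there exists Q ∈ L with K ∩ Q ≠ ∅}. Then the cardinality of I_L is at most γ(n), a constant depending only on n. -/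
open scoped ENNReal

noncomputable section

/-- Cubes of mutually comparable radii, each at a distance from `v` comparable to its radius and
none containing the center of another in its interior, are bounded in number. -/
theorem finite_ncard_le_of_separated {n : ℕ} {A B M : ℕ} (hM : A * A * B + 1 ≤ M)
    (v : Fin n → ℝ) (S : Set ((Fin n → ℝ) × ℝ)) (hpos : ∀ K ∈ S, 0 < K.2)
    (hsep : ∀ K ∈ S, ∀ K' ∈ S, K ≠ K' → K.2 ≤ dist K.1 K'.1)
    (hrad : ∀ K ∈ S, ∀ K' ∈ S, K.2 ≤ A * K'.2)
    (hdist : ∀ K ∈ S, dist K.1 v ≤ B * K.2) :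
    S.Finite ∧ S.ncard ≤ (Finset.Icc (fun _ => -M : Fin n → ℤ) (fun _ => M)).card := by
  rcases S.eq_empty_or_nonempty with rfl | ⟨K₀, hK₀⟩
  · simp
  have h0 := hpos K₀ hK₀
  have hA : (0 : ℝ) < A := by
    have := hrad K₀ hK₀ K₀ hK₀
    by_contra! h
    nlinarith
  let f : (Fin n → ℝ) × ℝ → Fin n → ℤ := fun K i => ⌊(K.1 i - v i) * A / K₀.2⌋
  have hmaps : Set.MapsTo f S (Finset.Icc (fun _ => -M : Fin n → ℤ) (fun _ => M)) := by
    intro K hK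
    have key (i : Fin n) : |(K.1 i - v i) * A / K₀.2| ≤ A * A * B := by
      have h1 : |K.1 i - v i| ≤ B * (A * K₀.2) :=
        calc |K.1 i - v i| = dist (K.1 i) (v i) := (Real.dist_eq _ _).symm
          _ ≤ dist K.1 v := dist_le_pi_dist _ _ i
          _ ≤ B * K.2 := hdist K hK
          _ ≤ B * (A * K₀.2) := by gcongr; exact hrad K hK K₀ hK₀
      rw [abs_div, abs_mul, abs_of_pos h0, abs_of_pos hA, div_le_iff₀ h0]
      calc |K.1 i - v i| * A ≤ B * (A * K₀.2) * A := by gcongr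
        _ = A * A * B * K₀.2 := by ring
    have hM' : (A * A * B + 1 : ℝ) ≤ M := by exact_mod_cast hM
    rw [Finset.mem_coe, Finset.mem_Icc]
    constructor
    · intro i
      change -(M : ℤ) ≤ ⌊_⌋
      rw [Int.le_floor]
      push_cast
      linarith [(abs_le.1 (key i)).1]
    · intro i
      change ⌊_⌋ ≤ (M : ℤ)
      have h2 : ((⌊(K.1 i - v i) * A / K₀.2⌋ : ℤ) : ℝ) ≤ (M : ℤ) := by
        push_cast
        linarith [(abs_le.1 (key i)).2, Int.floor_le ((K.1 i - v i) * A / K₀.2)]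
      exact_mod_cast h2
  have hinj : Set.InjOn f S := by
    intro K hK K' hK' hf
    by_contra hne
    have h1 := hsep K hK K' hK' hne
    have h2 : dist K.1 K'.1 < K.2 := by
      rw [dist_pi_lt_iff (hpos K hK)]
      intro i
      have h3 := Int.abs_sub_lt_one_of_floor_eq_floor (congrFun hf i)
      have h4 : (K.1 i - v i) * A / K₀.2 - (K'.1 i - v i) * A / K₀.2
          = (K.1 i - K'.1 i) * A / K₀.2 := by ring
      rw [h4, abs_div, abs_mul, abs_of_pos h0, abs_of_pos hA, div_lt_one h0] at h3
      rw [Real.dist_eq]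
      have h5 := hrad K₀ hK₀ K hK
      by_contra! h6
      nlinarith
    linarith
  refine ⟨Set.Finite.of_injOn hmaps hinj (Finset.finite_toSet _), ?_⟩
  rw [← Set.ncard_coe_finset]
  exact Set.ncard_le_ncard_of_injOn f hmaps hinj (Finset.finite_toSet _)

theorem two_mul_ofReal_le_ediam_cube {n : ℕ} [Nonempty (Fin n)] {Q : (Fin n → ℝ) × ℝ}
    (hQ : 0 ≤ Q.2) : ENNReal.ofReal (2 * Q.2) ≤ Metric.ediam (cube Q) := by
  have h1 : Q.1 + (fun _ => Q.2) ∈ cube Q := by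
    simp [cube, pi_norm_const, abs_of_nonneg hQ]
  have h2 : Q.1 - (fun _ => Q.2) ∈ cube Q := by
    simp [cube, pi_norm_const, abs_of_nonneg hQ]
  refine le_trans (le_of_eq ?_) (Metric.edist_le_ediam_of_mem h1 h2)
  rw [edist_dist, dist_eq_norm]
  have h3 : (Q.1 + fun _ => Q.2) - (Q.1 - fun _ => Q.2) = fun _ : Fin n => 2 * Q.2 := by
    ext i
    simp
    ring
  rw [h3, pi_norm_const, Real.norm_eq_abs, abs_of_nonneg (by positivity)]

theorem ediam_cube_le {n : ℕ} (Q : (Fin n → ℝ) × ℝ) :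
    Metric.ediam (cube Q) ≤ ENNReal.ofReal (2 * Q.2) := by
  refine Metric.ediam_le fun x hx y hy => ?_
  rw [edist_dist]
  refine ENNReal.ofReal_le_ofReal ?_
  have := dist_triangle_right x y Q.1
  rw [cube, Metric.mem_closedBall] at hx hy
  linarith

namespace IsWhitney

variable {n : ℕ} {E : Set (Fin n → ℝ)} {W : Set ((Fin n → ℝ) × ℝ)}

theorem two_mul_radius_le_dist_s8 (hW : IsWhitney E W) {Q : (Fin n → ℝ) × ℝ} (hQ : Q ∈ W)
    {x e : Fin n → ℝ} (hx : x ∈ cube Q) (he : e ∈ E) : 2 * Q.2 ≤ dist x e := by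
  have hr := hW.radius_pos Q hQ
  have hxE : x ∈ Eᶜ := hW.union_eq ▸ Set.mem_biUnion hQ hx
  have hne : x ≠ e := fun h => hxE (h ▸ he)
  obtain ⟨i, -⟩ := Function.ne_iff.1 hne
  have : Nonempty (Fin n) := ⟨i⟩
  have h : ENNReal.ofReal (2 * Q.2) ≤ edist x e :=
    calc ENNReal.ofReal (2 * Q.2) ≤ Metric.ediam (cube Q) := two_mul_ofReal_le_ediam_cube hr.le
      _ ≤ eSetDist (cube Q) E := hW.diam_le_dist Q hQ
      _ ≤ edist x e := iInf₂_le_of_le x hx (iInf₂_le e he)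
  rw [edist_dist] at h
  exact (ENNReal.ofReal_le_ofReal_iff dist_nonneg).1 h

theorem exists_dist_center_lt (hW : IsWhitney E W) {Q : (Fin n → ℝ) × ℝ} (hQ : Q ∈ W) :
    ∃ e ∈ E, dist e Q.1 < 19 / 2 * Q.2 := by
  have hr := hW.radius_pos Q hQ
  have h : eSetDist (cube Q) E < ENNReal.ofReal (17 / 2 * Q.2) :=
    calc eSetDist (cube Q) E ≤ 4 * Metric.ediam (cube Q) := hW.dist_le_diam Q hQ
      _ ≤ 4 * ENNReal.ofReal (2 * Q.2) := by gcongr; exact ediam_cube_le Q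
      _ = ENNReal.ofReal (4 * (2 * Q.2)) := by
        rw [ENNReal.ofReal_mul (p := 4) (by norm_num), ENNReal.ofReal_ofNat]
      _ < ENNReal.ofReal (17 / 2 * Q.2) := by
        rw [ENNReal.ofReal_lt_ofReal_iff (by positivity)]
        linarith
  simp only [eSetDist, iInf_lt_iff] at h
  obtain ⟨a, ha, e, he, hae⟩ := h
  rw [edist_dist, ENNReal.ofReal_lt_ofReal_iff (by positivity)] at hae
  rw [cube, Metric.mem_closedBall] at ha
  refine ⟨e, he, ?_⟩
  linarith [dist_triangle_left e Q.1 a]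

theorem radius_le_of_inter_nonempty (hW : IsWhitney E W) {Q K : (Fin n → ℝ) × ℝ} (hQ : Q ∈ W)
    (hK : K ∈ W) (h : (cube K ∩ cube Q).Nonempty) : K.2 ≤ 21 / 4 * Q.2 := by
  obtain ⟨x, hxK, hxQ⟩ := h
  obtain ⟨e, he, hd⟩ := hW.exists_dist_center_lt hQ
  have h1 := hW.two_mul_radius_le_dist_s8 hK hxK he
  rw [cube, Metric.mem_closedBall] at hxQ
  linarith [dist_triangle_right x e Q.1]

theorem radius_le_dist_center (hW : IsWhitney E W) {K K' : (Fin n → ℝ) × ℝ} (hK : K ∈ W)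
    (hK' : K' ∈ W) (hne : K ≠ K') : K.2 ≤ dist K.1 K'.1 := by
  by_contra! h
  have h1 : K'.1 ∈ Metric.ball K.1 K.2 := by rwa [Metric.mem_ball, dist_comm]
  have h2 : K'.1 ∈ interior (cube K) := Metric.ball_subset_interior_closedBall h1
  have h3 : K'.1 ∈ interior (cube K') :=
    Metric.ball_subset_interior_closedBall (Metric.mem_ball_self (hW.radius_pos K' hK'))
  exact Set.disjoint_left.1 (hW.nonoverlap K hK K' hK' hne) h2 h3

end IsWhitney

theorem dist_center_le_of_inter_nonempty {n : ℕ} {Q K : (Fin n → ℝ) × ℝ}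
    (h : (cube K ∩ cube Q).Nonempty) : dist K.1 Q.1 ≤ K.2 + Q.2 := by
  obtain ⟨x, hxK, hxQ⟩ := h
  rw [cube, Metric.mem_closedBall] at hxK hxQ
  linarith [dist_triangle_left K.1 Q.1 x]

/-- Let `L = L(V)` be a nonempty true lacuna of a nonempty set `V` and let
`I_L = {K ∈ W : K ∉ L, ∃ Q ∈ L with K ∩ Q ≠ ∅}`.  Then `#I_L ≤ γ(n)` for a constant
depending only on `n`. -/
theorem stmt8 (n : ℕ) :
    ∃ γ : ℕ,
      ∀ (E : Set (Fin n → ℝ)) (W : Set ((Fin n → ℝ) × ℝ)),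
        E.Nonempty → IsClosed E → IsWhitney E W →
        ∀ V : Set (Fin n → ℝ), V.Nonempty → (lacuna E W V).Nonempty →
          {K | K ∈ W ∧ K ∉ lacuna E W V ∧
              ∃ Q ∈ lacuna E W V, (cube K ∩ cube Q).Nonempty}.Finite ∧
          {K | K ∈ W ∧ K ∉ lacuna E W V ∧
              ∃ Q ∈ lacuna E W V, (cube K ∩ cube Q).Nonempty}.ncard ≤ γ := by
  obtain ⟨M, hM⟩ : ∃ M : ℕ, 210 * 210 * 59 + 1 ≤ M := ⟨_, le_rfl⟩
  let N := (Finset.Icc (fun _ => -M : Fin n → ℤ) (fun _ => M)).card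
  refine ⟨N + N, fun E W _ _ hW V ⟨v, hv⟩ _ => ?_⟩
  let I := {K | K ∈ W ∧ K ∉ lacuna E W V ∧
    ∃ Q ∈ lacuna E W V, (cube K ∩ cube Q).Nonempty}
  have in10 {Q} (hQ : Q ∈ lacuna E W V) {u} (hu : u ∈ V) : u ∈ E ∧ dist u Q.1 ≤ 10 * Q.2 := by
    rw [← hQ.2.1] at hu
    exact ⟨hu.2, hu.1⟩
  have in90 {Q} (hQ : Q ∈ lacuna E W V) {u} (hu : u ∈ E) (hd : dist u Q.1 ≤ 90 * Q.2) :
      u ∈ V := by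
    rw [← hQ.2.2]
    exact ⟨hd, hu⟩
  have hdist {K} (hK : K ∈ I) : dist K.1 v ≤ 59 * K.2 := by
    obtain ⟨hKW, -, Q, hQ, hKQ⟩ := hK
    have h1 := hW.radius_le_of_inter_nonempty hKW hQ.1 (Set.inter_comm _ _ ▸ hKQ)
    linarith [dist_triangle_right K.1 v Q.1, (in10 hQ hv).2,
      dist_center_le_of_inter_nonempty hKQ, hW.radius_pos K hKW]
  let Sa := {K ∈ I | ¬ V ⊆ dilate 10 K}
  let Sb := {K ∈ I | ¬ dilate 90 K ∩ E ⊆ V}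
  have hsub : I ⊆ Sa ∪ Sb := by
    intro K hK
    by_contra hcon
    simp only [Sa, Sb, Set.mem_union, Set.mem_ofPred_eq, hK, true_and, not_or, not_not] at hcon
    obtain ⟨hKW, hKL, Q, hQ, -⟩ := hK
    have h1 : V ⊆ dilate 10 K ∩ E := fun u hu => ⟨hcon.1 hu, (in10 hQ hu).1⟩
    have h2 : dilate 10 K ∩ E ⊆ dilate 90 K ∩ E := by
      refine Set.inter_subset_inter_left _ (Metric.closedBall_subset_closedBall ?_)
      linarith [hW.radius_pos K hKW]
    exact hKL ⟨hKW, (h2.trans hcon.2).antisymm h1, hcon.2.antisymm (h1.trans h2)⟩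
  have bound (S : Set ((Fin n → ℝ) × ℝ)) (hSI : S ⊆ I)
      (hrad : ∀ K ∈ S, ∀ K' ∈ S, K.2 ≤ 210 * K'.2) : S.Finite ∧ S.ncard ≤ N :=
    finite_ncard_le_of_separated hM v S (fun K hK => hW.radius_pos K (hSI hK).1)
      (fun K hK K' hK' => hW.radius_le_dist_center (hSI hK).1 (hSI hK').1)
      (by exact_mod_cast hrad) (fun K hK => by exact_mod_cast hdist (hSI hK))
  obtain ⟨haf, hac⟩ := bound Sa (Set.sep_subset _ _) (by
    rintro K ⟨⟨hKW, -, Q, hQ, hKQ⟩, hKV⟩ K' ⟨⟨hKW', -, Q', hQ', hKQ'⟩, -⟩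
    obtain ⟨u, hu, huK⟩ := Set.not_subset.1 hKV
    rw [dilate, Metric.mem_closedBall, not_le] at huK
    obtain ⟨e, he, hd⟩ := hW.exists_dist_center_lt hKW
    have hr := hW.radius_pos Q hQ.1
    have heV : e ∈ V := by
      refine in90 hQ he ?_
      linarith [dist_triangle e K.1 Q.1, dist_center_le_of_inter_nonempty hKQ,
        hW.radius_le_of_inter_nonempty hQ.1 hKW hKQ]
    have h1 := hW.radius_le_of_inter_nonempty hKW' hQ'.1 (Set.inter_comm _ _ ▸ hKQ')
    linarith [dist_triangle u e K.1, dist_triangle_right u e Q'.1, (in10 hQ' hu).2,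
      (in10 hQ' heV).2])
  obtain ⟨hbf, hbc⟩ := bound Sb (Set.sep_subset _ _) (by
    rintro K' ⟨⟨hKW', -, Q', hQ', hKQ'⟩, -⟩ K ⟨hKI, hKV⟩
    obtain ⟨e, ⟨heK, he⟩, heV⟩ := Set.not_subset.1 hKV
    rw [dilate, Metric.mem_closedBall] at heK
    have h1 : 90 * Q'.2 < dist e Q'.1 := not_le.1 fun h => heV (in90 hQ' he h)
    linarith [dist_triangle e v Q'.1, dist_triangle e K.1 v, (in10 hQ' hv).2, hdist hKI,
      hW.radius_le_of_inter_nonempty hQ'.1 hKW' hKQ', hW.radius_pos K hKI.1])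
  change I.Finite ∧ I.ncard ≤ N + N
  refine ⟨(haf.union hbf).subset hsub, ?_⟩
  calc I.ncard ≤ (Sa ∪ Sb).ncard := Set.ncard_le_ncard hsub (haf.union hbf)
    _ ≤ Sa.ncard + Sb.ncard := Set.ncard_union_le _ _
    _ ≤ N + N := add_le_add hac hbc
end
end

section
/- Let E be a finite nonempty subset of ℝⁿ. Then the total number of lacunae of E is at most C(n)·#E for a constant C(n) depending only on n; precisely, the number of distinct nonempty sets V for which the true lacuna L(V) = {Q ∈ W_E : (10Q) ∩ E = (90Q) ∩ E = V} is nonempty, plus the number of Whitney cubes Q ∈ W_E with (10Q) ∩ E ≠ (90Q) ∩ E (the elementary lacunae), does not exceed C(n)·#E. -/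
open scoped ENNReal

noncomputable section

/-- One stage of the farthest-point construction: separation radii `rad`, defined on a `τ`-net `S`
of `E` and governing all scales in `[τ, D)`, extend to the whole of `E` and to all positive scales
below `D`. -/
theorem exists_separation_radii_of_net {X : Type*} [PseudoMetricSpace X] [DecidableEq X]
    (E : Finset X) (D : ℝ) (k : ℕ) :
    ∀ (S : Finset X) (rad : X → ℝ) (τ : ℝ), S ⊆ E → (E \ S).card = k →
      (∀ e ∈ E, ∃ b ∈ S, dist e b ≤ τ) → (∀ b ∈ S, τ ≤ rad b) →
      (∀ a ∈ S, ∀ b ∈ S, a ≠ b → min (rad a) (rad b) ≤ dist a b) →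
      (∀ t, τ ≤ t → t < D → ∀ e ∈ E, ∃ b ∈ S, t < rad b ∧ dist e b ≤ t) →
      ∃ rad' : X → ℝ,
        (∀ a ∈ E, ∀ b ∈ E, a ≠ b → min (rad' a) (rad' b) ≤ dist a b) ∧
        (∀ t, 0 < t → t < D → ∀ e ∈ E, ∃ b ∈ E, t < rad' b ∧ dist e b ≤ t) := by
  induction k with
  | zero =>
    intro S rad τ hSE hk hnet hrad hsep hcov
    have hES : S = E := by
      rw [Finset.card_eq_zero, Finset.sdiff_eq_empty_iff_subset] at hk
      exact hSE.antisymm hk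
    subst hES
    refine ⟨rad, hsep, fun t ht htD e he => ?_⟩
    rcases le_or_gt τ t with h | h
    · exact hcov t h htD e he
    · exact ⟨e, he, h.trans_le (hrad e he), by simpa using ht.le⟩
  | succ k ih =>
    intro S rad τ hSE hk hnet hrad hsep hcov
    have hne : (E \ S).Nonempty := by
      rw [← Finset.card_pos]; omega
    have hS : S.Nonempty := by
      obtain ⟨e, he⟩ := hne
      obtain ⟨b, hb, -⟩ := hnet e (Finset.mem_sdiff.1 he).1
      exact ⟨b, hb⟩
    obtain ⟨p, hp, hmax⟩ := Finset.exists_max_image (E \ S) (fun e => S.inf' hS (dist e)) hne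
    obtain ⟨hpE, hpS⟩ := Finset.mem_sdiff.1 hp
    set σ := S.inf' hS (dist p) with hσ
    have hσle : ∀ b ∈ S, σ ≤ dist p b := fun b hb => Finset.inf'_le _ hb
    have hστ : σ ≤ τ := by
      obtain ⟨b, hb, h⟩ := hnet p hpE
      exact (hσle b hb).trans h
    have hσ0 : 0 ≤ σ := Finset.le_inf' _ _ fun b _ => dist_nonneg
    have hcovσ : ∀ e ∈ E, ∃ b ∈ S, dist e b ≤ σ := by
      intro e he
      by_cases heS : e ∈ S
      · exact ⟨e, heS, by simpa using hσ0⟩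
      · obtain ⟨b, hb, h⟩ := Finset.exists_mem_eq_inf' hS (dist e)
        exact ⟨b, hb, h ▸ hmax e (Finset.mem_sdiff.2 ⟨he, heS⟩)⟩
    have hupd : ∀ b ∈ S, Function.update rad p σ b = rad b := fun b hb =>
      Function.update_of_ne (ne_of_mem_of_not_mem hb hpS) _ _
    refine ih (insert p S) (Function.update rad p σ) σ (Finset.insert_subset hpE hSE) ?_ ?_ ?_ ?_ ?_
    · rw [Finset.sdiff_insert, Finset.card_erase_of_mem hp, hk, Nat.add_sub_cancel]
    · intro e he
      obtain ⟨b, hb, h⟩ := hcovσ e he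
      exact ⟨b, Finset.mem_insert_of_mem hb, h⟩
    · intro b hb
      rcases Finset.mem_insert.1 hb with rfl | hb
      · simp
      · rw [hupd b hb]; exact hστ.trans (hrad b hb)
    · intro a ha b hb hab
      rcases Finset.mem_insert.1 ha with rfl | haS
      · rcases Finset.mem_insert.1 hb with rfl | hbS
        · exact absurd rfl hab
        · exact (min_le_left _ _).trans (by simpa using hσle b hbS)
      · rcases Finset.mem_insert.1 hb with rfl | hbS
        · exact (min_le_right _ _).trans (by simpa [dist_comm] using hσle a haS)
        · rw [hupd a haS, hupd b hbS]; exact hsep a haS b hbS hab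
    · intro t ht htD e he
      rcases le_or_gt τ t with h | h
      · obtain ⟨b, hb, h1, h2⟩ := hcov t h htD e he
        exact ⟨b, Finset.mem_insert_of_mem hb, by rwa [hupd b hb], h2⟩
      · obtain ⟨b, hb, h1⟩ := hcovσ e he
        exact ⟨b, Finset.mem_insert_of_mem hb, by
          rw [hupd b hb]; exact h.trans_le (hrad b hb), h1.trans ht⟩

/-- A finite set `E` of diameter at most `D` carries separation radii such that, for every scale
`t ∈ (0, D)`, the points of `E` of radius more than `t` form a separated `t`-net of `E`. -/
theorem Set.Finite.exists_separation_radii {X : Type*} [PseudoMetricSpace X] {E : Set X}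
    (hE : E.Finite) (hne : E.Nonempty) {D : ℝ} (hD : ∀ a ∈ E, ∀ b ∈ E, dist a b ≤ D) :
    ∃ rad : X → ℝ,
      (∀ a ∈ E, ∀ b ∈ E, a ≠ b → min (rad a) (rad b) ≤ dist a b) ∧
      (∀ t, 0 < t → t < D → ∀ e ∈ E, ∃ b ∈ E, t < rad b ∧ dist e b ≤ t) := by
  classical
  obtain ⟨x, hx⟩ := hne
  have h := exists_separation_radii_of_net hE.toFinset D _ {x} (fun _ => D) D
    (by simpa using hx) rfl (fun e he => ⟨x, by simp, hD e (by simpa using he) x hx⟩)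
    (by simp)
    (fun a ha b hb hab => by
      rw [Finset.mem_singleton] at ha hb
      exact absurd (ha.trans hb.symm) hab)
    (fun t h1 h2 => absurd h1 h2.not_ge)
  simpa using h

/-- Two points of `E` at distance more than `2t` have a point of `E` near one of them whose
separation radius lies between `t` and the distance of the net points that approximate them. -/
theorem exists_separation_radius_between {X : Type*} [PseudoMetricSpace X] {E : Set X} {D t : ℝ}
    {rad : X → ℝ} (hsep : ∀ a ∈ E, ∀ b ∈ E, a ≠ b → min (rad a) (rad b) ≤ dist a b)
    (hcov : ∀ t, 0 < t → t < D → ∀ e ∈ E, ∃ b ∈ E, t < rad b ∧ dist e b ≤ t)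
    (ht : 0 < t) (htD : t < D) {p q : X} (hp : p ∈ E) (hq : q ∈ E) (hpq : 2 * t < dist p q) :
    ∃ a ∈ E, ∃ b ∈ E, dist p a ≤ t ∧ dist q b ≤ t ∧
      (t < rad a ∧ rad a ≤ dist a b ∨ t < rad b ∧ rad b ≤ dist a b) := by
  obtain ⟨a, haE, hat, hpa⟩ := hcov t ht htD p hp
  obtain ⟨b, hbE, hbt, hqb⟩ := hcov t ht htD q hq
  have hab : a ≠ b := by
    rintro rfl
    have := dist_triangle_right p q a
    linarith
  refine ⟨a, haE, b, hbE, hpa, hqb, ?_⟩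
  rcases min_le_iff.1 (hsep a haE b hbE hab) with h | h
  · exact Or.inl ⟨hat, h⟩
  · exact Or.inr ⟨hbt, h⟩

/-- Every Whitney cube has a point of `E` within `19/2` radii of its center. -/
theorem IsWhitney.exists_dist_lt {n : ℕ} {E : Set (Fin n → ℝ)} {W : Set ((Fin n → ℝ) × ℝ)}
    (hW : IsWhitney E W) {Q : (Fin n → ℝ) × ℝ} (hQ : Q ∈ W) :
    ∃ e ∈ E, dist Q.1 e < 19 / 2 * Q.2 := by
  have hr := hW.radius_pos Q hQ
  have h : eSetDist (cube Q) E < ENNReal.ofReal (17 / 2 * Q.2) := by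
    calc eSetDist (cube Q) E ≤ 4 * EMetric.diam (cube Q) := hW.dist_le_diam Q hQ
      _ ≤ 4 * ENNReal.ofReal (2 * Q.2) := by
          gcongr
          refine Metric.ediam_le_of_forall_dist_le fun x hx y hy => ?_
          have h1 : dist x Q.1 ≤ Q.2 := hx
          have h2 : dist y Q.1 ≤ Q.2 := hy
          linarith [dist_triangle_right x y Q.1]
      _ = ENNReal.ofReal (8 * Q.2) := by
          rw [← ENNReal.ofReal_ofNat, ← ENNReal.ofReal_mul (by norm_num)]
          congr 1; ring
      _ < ENNReal.ofReal (17 / 2 * Q.2) := by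
          rw [ENNReal.ofReal_lt_ofReal_iff (by positivity)]
          linarith
  simp only [eSetDist, iInf_lt_iff] at h
  obtain ⟨a, ha, b, hb, hab⟩ := h
  rw [edist_dist, ENNReal.ofReal_lt_ofReal_iff (by positivity)] at hab
  have ha' : dist a Q.1 ≤ Q.2 := ha
  exact ⟨b, hb, by linarith [dist_triangle_left Q.1 b a]⟩

/-- Distinct Whitney cubes have centers in distinct cells of a grid of mesh at most both radii. -/
theorem IsWhitney.eq_of_floor_eq {n : ℕ} {E : Set (Fin n → ℝ)} {W : Set ((Fin n → ℝ) × ℝ)}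
    (hW : IsWhitney E W) {Q Q' : (Fin n → ℝ) × ℝ} (hQ : Q ∈ W) (hQ' : Q' ∈ W) {s : ℝ}
    (hs : 0 < s) (hsQ : s ≤ Q.2) (b : Fin n → ℝ)
    (h : ∀ i, ⌊(Q.1 i - b i) / s⌋ = ⌊(Q'.1 i - b i) / s⌋) : Q = Q' := by
  by_contra hne
  refine Set.disjoint_left.1 (hW.nonoverlap Q hQ Q' hQ' hne) (?_ : Q'.1 ∈ _) ?_
  · apply Metric.ball_subset_interior_closedBall
    refine Metric.ball_subset_ball hsQ ?_
    rw [Metric.mem_ball, dist_comm, dist_pi_lt_iff hs]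
    intro i
    have h1 := Int.abs_sub_lt_one_of_floor_eq_floor (h i)
    rw [← sub_div, abs_div, abs_of_pos hs, div_lt_one hs] at h1
    simpa [Real.dist_eq] using h1
  · exact Metric.ball_subset_interior_closedBall (Metric.mem_ball_self (hW.radius_pos Q' hQ'))

/-- Each elementary lacuna lies near a point of `E` whose separation radius is comparable to
the radius of the cube. -/
theorem IsWhitney.exists_separation_radius_comparable {n : ℕ} {E : Set (Fin n → ℝ)}
    {W : Set ((Fin n → ℝ) × ℝ)} (hW : IsWhitney E W) {D : ℝ}
    (hD : ∀ a ∈ E, ∀ b ∈ E, dist a b ≤ D) {rad : (Fin n → ℝ) → ℝ}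
    (hsep : ∀ a ∈ E, ∀ b ∈ E, a ≠ b → min (rad a) (rad b) ≤ dist a b)
    (hcov : ∀ t, 0 < t → t < D → ∀ e ∈ E, ∃ b ∈ E, t < rad b ∧ dist e b ≤ t)
    {Q : (Fin n → ℝ) × ℝ} (hQ : Q ∈ W) (hne : dilate 10 Q ∩ E ≠ dilate 90 Q ∩ E) :
    ∃ b ∈ E, dist Q.1 b ≤ 91 * Q.2 ∧ Q.2 < 5 * rad b ∧ rad b ≤ 100 * Q.2 := by
  have hr := hW.radius_pos Q hQ
  obtain ⟨p, hp, hpQ⟩ := hW.exists_dist_lt hQ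
  obtain ⟨q, hq, hqQ, hqQ'⟩ : ∃ q ∈ E, dist Q.1 q ≤ 90 * Q.2 ∧ 10 * Q.2 < dist Q.1 q := by
    by_contra! hcon
    refine hne (Set.Subset.antisymm ?_ ?_)
    · rintro x ⟨hx, hxE⟩
      exact ⟨Metric.closedBall_subset_closedBall (by linarith) hx, hxE⟩
    · rintro x ⟨hx, hxE⟩
      refine ⟨?_, hxE⟩
      have hx' : dist x Q.1 ≤ 90 * Q.2 := hx
      have := hcon x hxE (by rwa [dist_comm])
      rwa [dist_comm] at this
  have hpq : Q.2 / 2 < dist p q := by linarith [dist_triangle Q.1 p q]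
  obtain ⟨a, haE, b, hbE, hpa, hqb, h⟩ := exists_separation_radius_between hsep hcov
    (t := Q.2 / 5) (by positivity) (by linarith [hD p hp q hq]) hp hq (by linarith)
  have hQa := dist_triangle Q.1 p a
  have hQb := dist_triangle Q.1 q b
  have hab := dist_triangle_left a b Q.1
  rcases h with ⟨h1, h2⟩ | ⟨h1, h2⟩
  · exact ⟨a, haE, by linarith, by linarith, by linarith⟩
  · exact ⟨b, hbE, by linarith, by linarith, by linarith⟩

/-- The elementary lacunae inject into the product of `E` with a fixed finite grid. -/
theorem IsWhitney.exists_injOn_elementary {n : ℕ} {E : Set (Fin n → ℝ)}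
    {W : Set ((Fin n → ℝ) × ℝ)} (hW : IsWhitney E W) (hE : E.Finite) (hne : E.Nonempty) :
    ∃ f : (Fin n → ℝ) × ℝ → (Fin n → ℝ) × (Fin n → ℤ),
      Set.MapsTo f {Q | Q ∈ W ∧ dilate 10 Q ∩ E ≠ dilate 90 Q ∩ E}
        (E ×ˢ (Fintype.piFinset fun _ : Fin n => Finset.Icc (-50000 : ℤ) 50000 :
          Set (Fin n → ℤ))) ∧
      Set.InjOn f {Q | Q ∈ W ∧ dilate 10 Q ∩ E ≠ dilate 90 Q ∩ E} := by
  have hD : ∀ a ∈ E, ∀ b ∈ E, dist a b ≤ Metric.diam E := fun a ha b hb =>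
    Metric.dist_le_diam_of_mem hE.isBounded ha hb
  obtain ⟨rad, hsep, hcov⟩ := hE.exists_separation_radii hne hD
  have hex : ∀ Q : (Fin n → ℝ) × ℝ, ∃ b, Q ∈ W ∧ dilate 10 Q ∩ E ≠ dilate 90 Q ∩ E →
      b ∈ E ∧ dist Q.1 b ≤ 91 * Q.2 ∧ Q.2 < 5 * rad b ∧ rad b ≤ 100 * Q.2 := by
    intro Q
    by_cases h : Q ∈ W ∧ dilate 10 Q ∩ E ≠ dilate 90 Q ∩ E
    · obtain ⟨b, hb⟩ := hW.exists_separation_radius_comparable hD hsep hcov h.1 h.2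
      exact ⟨b, fun _ => hb⟩
    · exact ⟨Q.1, fun h' => absurd h' h⟩
  choose b hb using hex
  refine ⟨fun Q => (b Q, fun i => ⌊(Q.1 i - b Q i) / (rad (b Q) / 100)⌋), ?_, ?_⟩
  · intro Q hQ
    obtain ⟨hbE, hdist, hlow, hup⟩ := hb Q hQ
    have hr := hW.radius_pos Q hQ.1
    have hs : 0 < rad (b Q) / 100 := by linarith
    refine ⟨hbE, ?_⟩
    rw [Finset.mem_coe, Fintype.mem_piFinset]
    intro i
    have hi : |Q.1 i - b Q i| ≤ 91 * Q.2 := by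
      rw [← Real.dist_eq]; exact (dist_le_pi_dist _ _ i).trans hdist
    rw [abs_le] at hi
    rw [Finset.mem_Icc]
    constructor
    · rw [Int.le_floor, le_div_iff₀ hs]
      push_cast
      linarith
    · refine Int.floor_le_iff.2 ?_
      rw [div_lt_iff₀ hs]
      push_cast
      linarith
  · intro Q hQ Q' hQ' heq
    rw [Prod.mk.injEq] at heq
    obtain ⟨hbb, hfl⟩ := heq
    obtain ⟨-, -, hlow, hup⟩ := hb Q hQ
    have hr := hW.radius_pos Q hQ.1
    rw [← hbb] at hfl
    exact hW.eq_of_floor_eq hQ.1 hQ'.1 (s := rad (b Q) / 100) (by linarith) (by linarith) (b Q)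
      (congrFun hfl)

/-- Two lacunary traces that share a point are equal unless the trace of the larger cube
has points far from the shared one, relative to the radius of the smaller cube. -/
theorem eq_or_exists_dist_gt_of_mem_lacuna {n : ℕ} {E : Set (Fin n → ℝ)}
    {W : Set ((Fin n → ℝ) × ℝ)} {V V' : Set (Fin n → ℝ)}
    {Q Q' : (Fin n → ℝ) × ℝ} (hQ : Q ∈ lacuna E W V) (hQ' : Q' ∈ lacuna E W V')
    (hrr : Q.2 ≤ Q'.2) {b : Fin n → ℝ} (hb : b ∈ V) (hb' : b ∈ V') :
    V = V' ∨ ∃ x ∈ V', 80 * Q.2 < dist x b := by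
  obtain ⟨-, h10, h90⟩ := hQ
  obtain ⟨-, h10', h90'⟩ := hQ'
  have hball : ∀ x ∈ V, dist x Q.1 ≤ 10 * Q.2 := fun x hx => (h10.symm ▸ hx :).1
  have hball' : ∀ x ∈ V', dist x Q'.1 ≤ 10 * Q'.2 := fun x hx => (h10'.symm ▸ hx :).1
  have hr : 0 ≤ Q.2 := by linarith [hball b hb, dist_nonneg (x := b) (y := Q.1)]
  have hsub : V ⊆ V' := by
    intro x hx
    rw [← h90']
    refine ⟨?_, (h10.symm ▸ hx :).2⟩
    rw [dilate, Metric.mem_closedBall]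
    linarith [hball x hx, hball b hb, hball' b hb', dist_triangle_right x b Q.1,
      dist_triangle x b Q'.1]
  by_cases hVV : V' ⊆ V
  · exact Or.inl (hsub.antisymm hVV)
  · obtain ⟨x, hx, hxV⟩ := Set.not_subset.1 hVV
    refine Or.inr ⟨x, hx, ?_⟩
    have hxE : x ∈ E := (h10'.symm ▸ hx :).2
    have hxQ : 90 * Q.2 < dist x Q.1 := by
      by_contra! hcon
      exact hxV (h90 ▸ ⟨hcon, hxE⟩)
    linarith [hball b hb, dist_triangle x b Q.1]

/-- The non-singleton lacunary traces inject into `E`, by a map selecting a point of the trace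
whose separation radius is comparable to the diameter of the trace. -/
theorem exists_injOn_lacunary_traces {n : ℕ} {E : Set (Fin n → ℝ)}
    {W : Set ((Fin n → ℝ) × ℝ)} (hE : E.Finite) (hne : E.Nonempty) :
    ∃ f : Set (Fin n → ℝ) → Fin n → ℝ,
      Set.MapsTo f {V | V.Nontrivial ∧ (lacuna E W V).Nonempty} E ∧
      Set.InjOn f {V | V.Nontrivial ∧ (lacuna E W V).Nonempty} := by
  have hD : ∀ a ∈ E, ∀ b ∈ E, dist a b ≤ Metric.diam E := fun a ha b hb =>
    Metric.dist_le_diam_of_mem hE.isBounded ha hb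
  obtain ⟨rad, hsep, hcov⟩ := hE.exists_separation_radii hne hD
  have hex : ∀ V : Set (Fin n → ℝ), ∃ b, V.Nontrivial ∧ (lacuna E W V).Nonempty →
      b ∈ E ∧ b ∈ V ∧ Metric.diam V < 3 * rad b ∧ rad b ≤ Metric.diam V := by
    intro V
    by_cases h : V.Nontrivial ∧ (lacuna E W V).Nonempty
    swap
    · exact ⟨0, fun h' => absurd h' h⟩
    obtain ⟨hV, Q, hQW, h10, h90⟩ := h
    have hVE : V ⊆ E := h10 ▸ Set.inter_subset_right
    have hVb : Bornology.IsBounded V := (hE.subset hVE).isBounded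
    have hball : ∀ x ∈ V, dist x Q.1 ≤ 10 * Q.2 := fun x hx => (h10.symm ▸ hx :).1
    obtain ⟨⟨p, q⟩, ⟨hp, hq⟩, hpq⟩ := Set.exists_max_image (V ×ˢ V) (fun z => dist z.1 z.2)
      ((hE.subset hVE).prod (hE.subset hVE)) (hV.nonempty.prod hV.nonempty)
    have hdiam : Metric.diam V = dist p q :=
      le_antisymm (Metric.diam_le_of_forall_dist_le dist_nonneg
        fun x hx y hy => hpq (x, y) ⟨hx, hy⟩) (Metric.dist_le_diam_of_mem hVb hp hq)
    have hpos : 0 < dist p q := by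
      obtain ⟨x, hx, y, hy, hxy⟩ := hV
      exact (dist_pos.2 hxy).trans_le (hpq (x, y) ⟨hx, hy⟩)
    obtain ⟨a, haE, b, hbE, hpa, hqb, h⟩ := exists_separation_radius_between hsep hcov
      (t := dist p q / 3) (by positivity) (by linarith [hD p (hVE hp) q (hVE hq)])
      (hVE hp) (hVE hq) (by linarith)
    have hmem : ∀ x ∈ V, ∀ y ∈ E, dist x y ≤ dist p q / 3 → y ∈ V := by
      intro x hx y hy hxy
      rw [← h90]
      refine ⟨?_, hy⟩
      rw [dilate, Metric.mem_closedBall]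
      linarith [hball x hx, hball p hp, hball q hq, dist_triangle_right p q Q.1,
        dist_triangle_left y Q.1 x, dist_nonneg (x := x) (y := Q.1)]
    have haV := hmem p hp a haE hpa
    have hbV := hmem q hq b hbE hqb
    have hab := Metric.dist_le_diam_of_mem hVb haV hbV
    rcases h with ⟨h1, h2⟩ | ⟨h1, h2⟩
    · exact ⟨a, fun _ => ⟨haE, haV, by linarith, by linarith⟩⟩
    · exact ⟨b, fun _ => ⟨hbE, hbV, by linarith, by linarith⟩⟩
  choose f hf using hex
  refine ⟨f, fun V hV => (hf V hV).1, ?_⟩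
  have key : ∀ V V' : Set (Fin n → ℝ), V.Nontrivial → V'.Nontrivial → f V = f V' →
      ∀ Q ∈ lacuna E W V, ∀ Q' ∈ lacuna E W V', Q.2 ≤ Q'.2 → V = V' := by
    intro V V' hV hV' heq Q hQ Q' hQ' hrr
    obtain ⟨-, hb, hlow, hup⟩ := hf V ⟨hV, Q, hQ⟩
    obtain ⟨-, hb', hlow', hup'⟩ := hf V' ⟨hV', Q', hQ'⟩
    rw [← heq] at hb' hlow'
    rcases eq_or_exists_dist_gt_of_mem_lacuna hQ hQ' hrr hb hb' with h | ⟨x, hx, hxb⟩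
    · exact h
    · exfalso
      have hVE' : V' ⊆ E := hQ'.2.1 ▸ Set.inter_subset_right
      have h1 := Metric.dist_le_diam_of_mem (hE.subset hVE').isBounded hx hb'
      have hball : ∀ x ∈ V, dist x Q.1 ≤ 10 * Q.2 := fun x hx => (hQ.2.1.symm ▸ hx :).1
      have hr : 0 ≤ Q.2 := by linarith [hball _ hb, dist_nonneg (x := f V) (y := Q.1)]
      have h2 : Metric.diam V ≤ 20 * Q.2 :=
        Metric.diam_le_of_forall_dist_le (by positivity) fun x hx y hy => by
          linarith [hball x hx, hball y hy, dist_triangle_right x y Q.1]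
      linarith
  rintro V ⟨hV, Q, hQ⟩ V' ⟨hV', Q', hQ'⟩ heq
  rcases le_total Q.2 Q'.2 with h | h
  · exact key V V' hV hV' heq Q hQ Q' hQ' h
  · exact (key V' V hV' hV heq.symm Q' hQ' Q hQ h).symm

/-- The nonempty lacunary traces number at most `2 · #E`. -/
theorem finite_and_ncard_lacunary_traces_le {n : ℕ} {E : Set (Fin n → ℝ)}
    {W : Set ((Fin n → ℝ) × ℝ)} (hE : E.Finite) (hne : E.Nonempty) :
    {V : Set (Fin n → ℝ) | V.Nonempty ∧ (lacuna E W V).Nonempty}.Finite ∧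
      {V : Set (Fin n → ℝ) | V.Nonempty ∧ (lacuna E W V).Nonempty}.ncard ≤ 2 * E.ncard := by
  obtain ⟨f, hmaps, hinj⟩ := exists_injOn_lacunary_traces (W := W) hE hne
  have hfin := Set.Finite.of_injOn hmaps hinj hE
  have hcard := Set.ncard_le_ncard_of_injOn f hmaps hinj hE
  have hsub : {V : Set (Fin n → ℝ) | V.Nonempty ∧ (lacuna E W V).Nonempty} ⊆
      (fun x => {x}) '' E ∪ {V | V.Nontrivial ∧ (lacuna E W V).Nonempty} := by
    rintro V ⟨hV, hL⟩
    rcases hV.exists_eq_singleton_or_nontrivial with ⟨x, rfl⟩ | h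
    · obtain ⟨Q, -, h10, -⟩ := hL
      exact Or.inl ⟨x, (h10.symm ▸ Set.mem_singleton x :).2, rfl⟩
    · exact Or.inr ⟨h, hL⟩
  have hfin' := (hE.image fun x => ({x} : Set (Fin n → ℝ))).union hfin
  refine ⟨hfin'.subset hsub, ?_⟩
  have h1 := Set.ncard_le_ncard hsub hfin'
  have h2 := Set.ncard_union_le ((fun x => ({x} : Set (Fin n → ℝ))) '' E)
    {V | V.Nontrivial ∧ (lacuna E W V).Nonempty}
  have h3 := Set.ncard_image_le (f := fun x => ({x} : Set (Fin n → ℝ))) hE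
  omega

/-- For a finite nonempty set `E ⊆ ℝⁿ`, the total number of lacunae of `E` — the number of
distinct nonempty sets `V` whose true lacuna `L(V)` is nonempty, plus the number of Whitney
cubes `Q ∈ W_E` with `(10Q) ∩ E ≠ (90Q) ∩ E` (the elementary lacunae) — is at most
`C(n)·#E` for a constant `C(n)` depending only on `n`. -/
theorem stmt9 (n : ℕ) :
    ∃ C : ℕ,
      ∀ (E : Set (Fin n → ℝ)) (W : Set ((Fin n → ℝ) × ℝ)),
        E.Finite → E.Nonempty → IsClosed E → IsWhitney E W →
          {V : Set (Fin n → ℝ) | V.Nonempty ∧ (lacuna E W V).Nonempty}.Finite ∧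
          {Q | Q ∈ W ∧ dilate 10 Q ∩ E ≠ dilate 90 Q ∩ E}.Finite ∧
          {V : Set (Fin n → ℝ) | V.Nonempty ∧ (lacuna E W V).Nonempty}.ncard +
              {Q | Q ∈ W ∧ dilate 10 Q ∩ E ≠ dilate 90 Q ∩ E}.ncard ≤
            C * E.ncard := by
  refine ⟨2 + (Fintype.piFinset fun _ : Fin n => Finset.Icc (-50000 : ℤ) 50000).card, ?_⟩
  intro E W hE hne _ hW
  obtain ⟨f, hmaps, hinj⟩ := hW.exists_injOn_elementary hE hne
  have hfin := hE.prod (Finset.finite_toSet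
    (Fintype.piFinset fun _ : Fin n => Finset.Icc (-50000 : ℤ) 50000))
  obtain ⟨hVfin, hVcard⟩ := finite_and_ncard_lacunary_traces_le (W := W) hE hne
  refine ⟨hVfin, Set.Finite.of_injOn hmaps hinj hfin, ?_⟩
  have hcard := Set.ncard_le_ncard_of_injOn f hmaps hinj hfin
  rw [Set.ncard_prod, Set.ncard_coe_finset] at hcard
  rw [add_mul, mul_comm _ E.ncard, mul_comm _ E.ncard]
  rw [mul_comm] at hVcard
  exact add_le_add hVcard hcard
end
end

section
/- Let A, B, A', B' ∈ ℝ² with A ≠ B, A' ≠ B', and {A,B} ∩ {A',B'} = ∅. Then there exist points C ∈ {A,B} and C' ∈ {A',B'} such that: in the triple {A, B, C'}, the side opposite to the vertex C is not the smallest side; and in the triple {A', B', C}, the side opposite to the vertex C' is not the smallest side. -/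
/-- Two pairs of points `{A, B}` and `{A', B'}` can be relabelled so that `C` is at least as close
as `D` to `C'`, and `C'` is at least as close as `D'` to `C`. -/
theorem exists_nearest_pair {E : Type*} [SeminormedAddCommGroup E] (A B A' B' : E) :
    ∃ C D C' D' : E, ({C, D} : Set E) = {A, B} ∧ ({C', D'} : Set E) = {A', B'} ∧
      ‖C' - C‖ ≤ ‖D - C'‖ ∧ ‖C - C'‖ ≤ ‖D' - C‖ := by
  have key : ∀ C D C' D' : E, ‖C - C'‖ ≤ ‖D - C'‖ → ‖C - C'‖ ≤ ‖C - D'‖ →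
      ‖C' - C‖ ≤ ‖D - C'‖ ∧ ‖C - C'‖ ≤ ‖D' - C‖ := fun C D C' D' h h' =>
    ⟨by rwa [norm_sub_rev C' C], by rwa [norm_sub_rev D' C]⟩
  rcases le_total ‖A - A'‖ ‖B - A'‖ with h₁ | h₁ <;>
  rcases le_total ‖A - B'‖ ‖B - B'‖ with h₂ | h₂ <;>
  rcases le_total ‖A - A'‖ ‖A - B'‖ with h₃ | h₃ <;>
  rcases le_total ‖B - A'‖ ‖B - B'‖ with h₄ | h₄ <;>
  first
  | exact ⟨A, B, A', B', rfl, rfl, key _ _ _ _ (by linarith) (by linarith)⟩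
  | exact ⟨A, B, B', A', rfl, Set.pair_comm _ _, key _ _ _ _ (by linarith) (by linarith)⟩
  | exact ⟨B, A, A', B', Set.pair_comm _ _, rfl, key _ _ _ _ (by linarith) (by linarith)⟩
  | exact ⟨B, A, B', A', Set.pair_comm _ _, Set.pair_comm _ _,
      key _ _ _ _ (by linarith) (by linarith)⟩

/-- Existence of exterior bridges: given `A ≠ B`, `A' ≠ B'` in `ℝ²` (uniform norm) with
`{A,B} ∩ {A',B'} = ∅`, there are `C ∈ {A,B}` and `C' ∈ {A',B'}` (with `D`, `D'` the
respective remaining points) such that in the triple `{A, B, C'}` the side opposite the vertex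
`C`, namely `[D, C']`, is not the smallest side, and in the triple `{A', B', C}` the side
opposite the vertex `C'`, namely `[D', C]`, is not the smallest side.  (A side `[X,Y]` of a
triple `{X,Y,Z}` is the smallest side when `‖X - Y‖ < min (‖X - Z‖) (‖Y - Z‖)`.) -/
theorem stmt10 (A B A' B' : Fin 2 → ℝ) (hAB : A ≠ B) (hA'B' : A' ≠ B')
    (hdisj : ({A, B} : Set (Fin 2 → ℝ)) ∩ ({A', B'} : Set (Fin 2 → ℝ)) = ∅) :
    ∃ C D C' D' : Fin 2 → ℝ,
      ({C, D} : Set (Fin 2 → ℝ)) = ({A, B} : Set (Fin 2 → ℝ)) ∧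
      ({C', D'} : Set (Fin 2 → ℝ)) = ({A', B'} : Set (Fin 2 → ℝ)) ∧
      min ‖D - C‖ ‖C' - C‖ ≤ ‖D - C'‖ ∧
      min ‖D' - C'‖ ‖C - C'‖ ≤ ‖D' - C‖ := by
  obtain ⟨C, D, C', D', h, h', hD, hD'⟩ := exists_nearest_pair A B A' B'
  exact ⟨C, D, C', D', h, h', (min_le_right _ _).trans hD, (min_le_right _ _).trans hD'⟩
end

section
/- Let Δ = {A, B, D} be a triangle, i.e., three non-collinear points in ℝ², and suppose that the side [A,B] opposite to the vertex D is not the smallest side of Δ, i.e., ‖A − B‖₂ ≥ min(‖A − D‖₂, ‖B − D‖₂). Let α be the angle of Δ at the vertex D. Then (1/4)·κ_Δ·diam₂ Δ ≤ sin α ≤ (1/2)·κ_Δ·diam₂ Δ. -/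
open Affine EuclideanGeometry in
/-- The law of sines in the Euclidean plane, for a triangle whose circumscribed circle is given by
its center `o` and radius `R`: each side is `2R` times the sine of the opposite angle. -/
theorem dist_eq_two_mul_radius_mul_sin_angle {A B D o : EuclideanSpace ℝ (Fin 2)} {R : ℝ}
    (hcol : ¬ Collinear ℝ ({A, B, D} : Set (EuclideanSpace ℝ (Fin 2))))
    (hoA : dist o A = R) (hoB : dist o B = R) (hoD : dist o D = R) :
    dist A B = 2 * R * Real.sin (∠ A D B) := by
  let t : Triangle ℝ (EuclideanSpace ℝ (Fin 2)) :=
    ⟨![A, B, D], affineIndependent_iff_not_collinear_set.2 hcol⟩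
  have hspan : affineSpan ℝ (Set.range t.points) = ⊤ := by
    rw [t.independent.affineSpan_eq_top_iff_card_eq_finrank_add_one]
    simp
  have hR : R = t.circumradius := by
    refine t.eq_circumradius_of_dist_eq (p := o) (hspan ▸ AffineSubspace.mem_top ℝ _ o) fun i => ?_
    rw [dist_comm]
    fin_cases i <;> assumption
  have hsin : dist A B / Real.sin (∠ A D B) = 2 * t.circumradius :=
    t.dist_div_sin_angle_eq_two_mul_circumradius (i₁ := 0) (i₂ := 2) (i₃ := 1)
      (by decide) (by decide) (by decide)
  have hpos := t.circumradius_pos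
  have hne : Real.sin (∠ A D B) ≠ 0 := by
    intro h
    rw [h, div_zero] at hsin
    linarith
  rw [hR, ← hsin, div_mul_cancel₀ _ hne]

/-- If one side of a triangle is not the smallest one, then the diameter is at most twice
that side. -/
theorem diam_triple_le_two_mul_dist {X : Type*} [MetricSpace X] {A B D : X}
    (hside : min (dist A D) (dist B D) ≤ dist A B) :
    Metric.diam ({A, B, D} : Set X) ≤ 2 * dist A B := by
  have hA := dist_triangle A B D
  have hB := dist_triangle_left B D A
  have h₀ : 0 ≤ dist A B := dist_nonneg
  rw [Metric.diam_triple, max_le_iff, max_le_iff]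
  rcases min_le_iff.1 hside with h | h <;> refine ⟨⟨?_, ?_⟩, ?_⟩ <;> linarith

/-- Let `Δ = {A, B, D}` be a (true) triangle in Euclidean `ℝ²` with circumcenter `o` and
circumradius `R`, and suppose the side `[A, B]` opposite the vertex `D` is not the smallest
side, i.e. `min (‖A - D‖₂) (‖B - D‖₂) ≤ ‖A - B‖₂`.  Let `α` be the angle of `Δ` at `D`.
Then `(1/4)·κ_Δ·diam₂ Δ ≤ sin α ≤ (1/2)·κ_Δ·diam₂ Δ`, where `κ_Δ = 1/R` is the Menger
curvature of `Δ`. -/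
theorem stmt11 (A B D o : EuclideanSpace ℝ (Fin 2)) (R : ℝ) (hR : 0 < R)
    (hcol : ¬ Collinear ℝ ({A, B, D} : Set (EuclideanSpace ℝ (Fin 2))))
    (hoA : dist o A = R) (hoB : dist o B = R) (hoD : dist o D = R)
    (hside : min (dist A D) (dist B D) ≤ dist A B) :
    (1 / 4) * (1 / R) * Metric.diam ({A, B, D} : Set (EuclideanSpace ℝ (Fin 2))) ≤
        Real.sin (EuclideanGeometry.angle A D B) ∧
      Real.sin (EuclideanGeometry.angle A D B) ≤
        (1 / 2) * (1 / R) * Metric.diam ({A, B, D} : Set (EuclideanSpace ℝ (Fin 2))) := by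
  have hsin : Real.sin (EuclideanGeometry.angle A D B) = 1 / 2 * (1 / R) * dist A B := by
    rw [dist_eq_two_mul_radius_mul_sin_angle hcol hoA hoB hoD]
    field_simp
  have hupper := diam_triple_le_two_mul_dist hside
  have hlower : dist A B ≤ Metric.diam ({A, B, D} : Set (EuclideanSpace ℝ (Fin 2))) :=
    Metric.dist_le_diam_of_mem (Set.toFinite _).isBounded (by simp) (by simp)
  have hκ : 0 < 1 / R := one_div_pos.2 hR
  rw [hsin]
  constructor <;> nlinarith
end

section
/- Let 2 < q < ∞. There exists a constant C depending only on q with the following property. Let F : ℝ² → ℝ be a C² function, let Δ = {z₁, z₂, z₃} be a triangle (three non-collinear points in ℝ²), let Q be a square with Δ ⊆ Q, and let x ∈ Q. Let P_Δ[F] be the unique affine polynomial with P_Δ[F](z_i) = F(z_i) for i = 1,2,3. Then ‖∇P_Δ[F] − ∇F(x)‖₂ ≤ C · (R_Δ / diam Δ) · diam Q · ( (1/|Q|) ∫_Q |∇²F(z)|^q dz )^{1/q}. -/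
open MeasureTheory
open scoped RealInnerProductSpace

noncomputable section

/-- The plane `ℝ²`, regarded as a Euclidean space. -/
abbrev E2 := EuclideanSpace ℝ (Fin 2)

/-- The square `Q(c,r)`: the closed ball of center `c` and radius `r` in the uniform norm,
regarded as a subset of Euclidean `ℝ²`. -/
def square (c : E2) (r : ℝ) : Set E2 := {y : E2 | ∀ i, |y i - c i| ≤ r}

/-- `|∇²F(z)|`: the Euclidean norm of the vector of all second-order partial derivatives
of `F` at `z`. -/
def hessNorm (F : E2 → ℝ) (z : E2) : ℝ :=
  Real.sqrt (∑ i : Fin 2, ∑ j : Fin 2,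
    (iteratedFDeriv ℝ 2 F z ![EuclideanSpace.single i (1 : ℝ),
      EuclideanSpace.single j (1 : ℝ)]) ^ 2)

theorem norm_fderiv_fderiv_le_hessNorm (F : E2 → ℝ) (z : E2) :
    ‖fderiv ℝ (fderiv ℝ F) z‖ ≤ hessNorm F z := by
  refine ContinuousLinearMap.opNorm_le_bound₂ _ (Real.sqrt_nonneg _) fun a b => ?_
  set B := fderiv ℝ (fderiv ℝ F) z with hB
  have key : ∀ u : E2, u = ∑ i, u i • EuclideanSpace.single i (1 : ℝ) := by
    intro u
    ext j
    fin_cases j <;> simp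
  have hh : hessNorm F z = Real.sqrt (∑ i : Fin 2, ∑ j : Fin 2,
      (B (EuclideanSpace.single i (1 : ℝ)) (EuclideanSpace.single j (1 : ℝ))) ^ 2) := by
    simp [hessNorm, iteratedFDeriv_two_apply, hB]
  have hab : B a b = ∑ i : Fin 2, ∑ j : Fin 2, a i * b j *
      B (EuclideanSpace.single i (1 : ℝ)) (EuclideanSpace.single j (1 : ℝ)) := by
    conv_lhs => rw [key a, key b]
    simp only [Fin.sum_univ_two, map_add, map_smul, add_apply,
      smul_apply, smul_eq_mul]
    ring
  rw [hh, hab, EuclideanSpace.norm_eq, EuclideanSpace.norm_eq, Real.norm_eq_abs,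
    ← Real.sqrt_mul (by positivity), ← Real.sqrt_mul (by positivity)]
  refine Real.abs_le_sqrt ?_
  have hcs := Finset.sum_mul_sq_le_sq_mul_sq (Finset.univ : Finset (Fin 2 × Fin 2))
    (fun p => B (EuclideanSpace.single p.1 (1 : ℝ)) (EuclideanSpace.single p.2 (1 : ℝ)))
    (fun p => a p.1 * b p.2)
  simp only [Fintype.sum_prod_type, Fin.sum_univ_two, Real.norm_eq_abs, sq_abs] at hcs ⊢
  nlinarith [hcs]

theorem continuous_hessNorm {F : E2 → ℝ} (hF : ContDiff ℝ 2 F) : Continuous (hessNorm F) := by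
  have h : Continuous fun z => iteratedFDeriv ℝ 2 F z := hF.continuous_iteratedFDeriv le_rfl
  unfold hessNorm
  fun_prop

theorem convex_square (c : E2) (r : ℝ) : Convex ℝ (square c r) := by
  have h : square c r = ⋂ i : Fin 2, (fun y : E2 => y i) ⁻¹' Metric.closedBall (c i) r := by
    ext y
    simp [square, Real.dist_eq]
  rw [h]
  exact convex_iInter fun i =>
    (convex_closedBall _ _).linear_preimage (EuclideanSpace.proj i : E2 →L[ℝ] ℝ).toLinearMap

theorem square_eq_preimage (c : E2) {r : ℝ} (hr : 0 ≤ r) :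
    square c r = (EuclideanSpace.equiv (Fin 2) ℝ).toHomeomorph ⁻¹'
      Metric.closedBall (EuclideanSpace.equiv (Fin 2) ℝ c) r := by
  ext y
  simp [square, dist_pi_le_iff hr, Real.dist_eq]

theorem isCompact_square (c : E2) {r : ℝ} (hr : 0 ≤ r) : IsCompact (square c r) := by
  rw [square_eq_preimage c hr, Homeomorph.isCompact_preimage]
  exact isCompact_closedBall _ _

theorem volume_square_pos (c : E2) {r : ℝ} (hr : 0 < r) : 0 < volume (square c r) := by
  refine Measure.measure_pos_of_nonempty_interior _ ⟨c, ?_⟩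
  rw [square_eq_preimage c hr.le, ← Homeomorph.preimage_interior]
  exact Metric.ball_subset_interior_closedBall (Metric.mem_ball_self hr)

/-- Contracting a convex set towards one of its points increases the integral of a nonnegative
function by at most the inverse Jacobian. -/
theorem setIntegral_comp_contraction_le {Q : Set E2} (hQ : IsCompact Q) (hconv : Convex ℝ Q)
    {k : E2 → ℝ} (hk : Continuous k) (hk0 : ∀ z, 0 ≤ k z) {x : E2} (hx : x ∈ Q) {t : ℝ}
    (ht0 : 0 < t) (ht1 : t ≤ 1) :
    ∫ y in Q, k (x + t • (y - x)) ≤ (t ^ 2)⁻¹ * ∫ z in Q, k z := by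
  have hm := hQ.isClosed.measurableSet
  have hint : Integrable (Q.indicator k) :=
    (integrable_indicator_iff hm).2 (hk.continuousOn.integrableOn_compact hQ)
  have hint2 : Integrable fun y => Q.indicator k (x + t • (y - x)) := by
    have h1 : Integrable fun y => Q.indicator k (x + y) := hint.comp_add_left x
    exact (h1.comp_smul ht0.ne').comp_sub_right x
  have hcv : ∫ y, Q.indicator k (x + t • (y - x)) = (t ^ 2)⁻¹ * ∫ z in Q, k z := by
    rw [integral_sub_right_eq_self (fun y => Q.indicator k (x + t • y)) x,
      Measure.integral_comp_smul volume (fun y => Q.indicator k (x + y)) t,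
      integral_add_left_eq_self, integral_indicator hm]
    simp [abs_of_pos ht0]
  rw [← hcv, ← integral_indicator hm]
  refine integral_mono ?_ hint2 fun y => ?_
  · refine (integrable_indicator_iff hm).2 (ContinuousOn.integrableOn_compact hQ ?_)
    fun_prop
  · by_cases hy : y ∈ Q
    · have hmem : x + t • (y - x) ∈ Q := hconv.add_smul_sub_mem hx hy ⟨ht0.le, ht1⟩
      simp [hy, hmem]
    · simp only [Set.indicator_of_notMem hy]
      exact Set.indicator_nonneg (fun z _ => hk0 z) _

/-- Jensen's inequality for the power function on a compact set of positive measure. -/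
theorem setIntegral_le_mul_rpow_average {Q : Set E2} (hQ : IsCompact Q) (hpos : 0 < volume Q)
    {q : ℝ} (hq : 1 ≤ q) {k : E2 → ℝ} (hk : Continuous k) (hk0 : ∀ z, 0 ≤ k z) :
    ∫ y in Q, k y ≤ (volume Q).toReal *
      ((volume Q).toReal⁻¹ * ∫ y in Q, k y ^ q) ^ (1 / q) := by
  have hfin : volume Q ≠ ⊤ := hQ.measure_lt_top.ne
  have hV : 0 < (volume Q).toReal := ENNReal.toReal_pos hpos.ne' hfin
  have hkq : Continuous fun y => k y ^ q := hk.rpow_const fun _ => Or.inr (by linarith)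
  have hJ := (convexOn_rpow hq).map_set_average_le (μ := volume) (t := Q) (f := k)
    (Real.continuous_rpow_const (by linarith)).continuousOn isClosed_Ici hpos.ne' hfin
    (Filter.Eventually.of_forall hk0) (hk.continuousOn.integrableOn_compact hQ)
    (hkq.continuousOn.integrableOn_compact hQ)
  simp only [setAverage_eq, smul_eq_mul, Measure.real] at hJ
  have hI : 0 ≤ (volume Q).toReal⁻¹ * ∫ y in Q, k y :=
    mul_nonneg (by positivity) (integral_nonneg hk0)
  have h2 := (Real.le_rpow_inv_iff_of_pos hI ((Real.rpow_nonneg hI q).trans hJ)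
    (by linarith : 0 < q)).2 hJ
  rw [one_div]
  calc ∫ y in Q, k y = (volume Q).toReal * ((volume Q).toReal⁻¹ * ∫ y in Q, k y) := by
        field_simp
    _ ≤ _ := by gcongr

theorem norm_sub_le_mul_integral {V : Type*} [NormedAddCommGroup V] [NormedSpace ℝ V]
    [CompleteSpace V] {G : E2 → V} (hG : ContDiff ℝ 1 G) {h : E2 → ℝ} (hh : Continuous h)
    (hGh : ∀ z, ‖fderiv ℝ G z‖ ≤ h z) (x y : E2) :
    ‖G x - G y‖ ≤ ‖y - x‖ * ∫ t in (0 : ℝ)..1, h (x + t • (y - x)) := by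
  have hline : ∀ t : ℝ, HasDerivAt (fun t : ℝ => x + t • (y - x)) (y - x) t := fun t => by
    simpa using ((hasDerivAt_id t).smul_const (y - x)).const_add x
  have hder : ∀ t : ℝ, HasDerivAt (fun t : ℝ => G (x + t • (y - x)))
      (fderiv ℝ G (x + t • (y - x)) (y - x)) t := fun t =>
    ((hG.differentiable one_ne_zero) _).hasFDerivAt.comp_hasDerivAt t (hline t)
  have hfd : Continuous (fderiv ℝ G) := hG.continuous_fderiv one_ne_zero
  have hc : Continuous fun t : ℝ => fderiv ℝ G (x + t • (y - x)) (y - x) := by fun_prop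
  have heq := intervalIntegral.integral_eq_sub_of_hasDerivAt (a := 0) (b := 1)
    (fun t _ => hder t) (hc.intervalIntegrable 0 1)
  simp only [one_smul, zero_smul, add_zero, add_sub_cancel] at heq
  rw [norm_sub_rev, ← heq, ← intervalIntegral.integral_const_mul]
  refine intervalIntegral.norm_integral_le_of_norm_le zero_le_one
    (Filter.Eventually.of_forall fun t _ => ?_) (Continuous.intervalIntegrable (by fun_prop) _ _)
  rw [mul_comm]
  exact (ContinuousLinearMap.le_opNorm _ _).trans
    (mul_le_mul_of_nonneg_right (hGh _) (norm_nonneg _))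

theorem setIntegral_integral_segment_le {Q : Set E2} (hQ : IsCompact Q) (hconv : Convex ℝ Q)
    (hpos : 0 < volume Q) {q : ℝ} (hq : 2 < q) {h : E2 → ℝ} (hh : Continuous h)
    (hh0 : ∀ z, 0 ≤ h z) {x : E2} (hx : x ∈ Q) :
    ∫ y in Q, ∫ t in (0 : ℝ)..1, h (x + t • (y - x)) ≤ (volume Q).toReal * (q / (q - 2)) *
      ((volume Q).toReal⁻¹ * ∫ z in Q, h z ^ q) ^ (1 / q) := by
  set A := ((volume Q).toReal⁻¹ * ∫ z in Q, h z ^ q) with hA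
  have hA0 : 0 ≤ A := mul_nonneg (by positivity) (integral_nonneg fun z => Real.rpow_nonneg (hh0 z) q)
  have hq0 : 0 < q := by linarith
  have hint : Integrable (Function.uncurry fun (y : E2) (t : ℝ) => h (x + t • (y - x)))
      ((volume.restrict Q).prod (volume.restrict (Set.Ioc (0 : ℝ) 1))) := by
    rw [Measure.prod_restrict]
    have hc : Continuous (Function.uncurry fun (y : E2) (t : ℝ) => h (x + t • (y - x))) := by
      unfold Function.uncurry
      fun_prop
    exact (hc.continuousOn.integrableOn_compact (hQ.prod (isCompact_Icc (a := (0 : ℝ)) (b := 1)))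
      ).mono_set (Set.prod_mono_right Set.Ioc_subset_Icc_self)
  have hexp : -1 < -(2 / q) := by
    rw [neg_lt_neg_iff, div_lt_one hq0]
    exact hq
  have hslice : ∀ t ∈ Set.Ioc (0 : ℝ) 1, ∫ y in Q, h (x + t • (y - x)) ≤
      (volume Q).toReal * A ^ (1 / q) * t ^ (-(2 / q)) := by
    intro t ht
    have h1 := setIntegral_le_mul_rpow_average hQ hpos (by linarith : 1 ≤ q)
      (k := fun y => h (x + t • (y - x))) (by fun_prop) (fun y => hh0 _)
    have h2 := setIntegral_comp_contraction_le hQ hconv (k := fun z => h z ^ q)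
      (hh.rpow_const fun _ => Or.inr hq0.le) (fun z => Real.rpow_nonneg (hh0 z) q) hx ht.1 ht.2
    refine h1.trans ?_
    have h3 : ((volume Q).toReal⁻¹ * ∫ y in Q, h (x + t • (y - x)) ^ q) ^ (1 / q) ≤
        ((t ^ 2)⁻¹ * A) ^ (1 / q) := by
      refine Real.rpow_le_rpow (mul_nonneg (by positivity)
        (integral_nonneg fun z => Real.rpow_nonneg (hh0 _) q)) ?_ (by positivity)
      rw [hA, mul_left_comm]
      gcongr
    have h4 : ((t ^ 2)⁻¹ * A) ^ (1 / q) = A ^ (1 / q) * t ^ (-(2 / q)) := by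
      rw [Real.mul_rpow (by positivity) hA0, mul_comm]
      congr 1
      rw [← Real.rpow_natCast, ← Real.rpow_neg ht.1.le, ← Real.rpow_mul ht.1.le]
      congr 1
      push_cast
      ring
    calc _ ≤ (volume Q).toReal * ((t ^ 2)⁻¹ * A) ^ (1 / q) := by gcongr
      _ = _ := by rw [h4, mul_assoc]
  simp only [intervalIntegral.integral_of_le zero_le_one]
  rw [integral_integral_swap hint]
  have hpow : IntegrableOn (fun t : ℝ => (volume Q).toReal * A ^ (1 / q) * t ^ (-(2 / q)))
      (Set.Ioc 0 1) := by
    rw [← intervalIntegrable_iff_integrableOn_Ioc_of_le zero_le_one]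
    exact (intervalIntegral.intervalIntegrable_rpow' hexp).const_mul _
  calc ∫ t in Set.Ioc (0 : ℝ) 1, ∫ y in Q, h (x + t • (y - x))
      ≤ ∫ t in Set.Ioc (0 : ℝ) 1, (volume Q).toReal * A ^ (1 / q) * t ^ (-(2 / q)) :=
        setIntegral_mono_on hint.integral_prod_right hpow measurableSet_Ioc hslice
    _ = (volume Q).toReal * (q / (q - 2)) * A ^ (1 / q) := by
        rw [← intervalIntegral.integral_of_le zero_le_one, intervalIntegral.integral_const_mul,
          integral_rpow (Or.inl hexp), Real.one_rpow, Real.zero_rpow (by linarith)]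
        have : q - 2 ≠ 0 := by linarith
        have h5 : -(2 / q) + 1 = (q - 2) / q := by field_simp; ring
        rw [h5]
        field_simp
        ring

/-- Morrey's inequality on a compact convex planar set. -/
theorem norm_sub_le_of_convex {V : Type*} [NormedAddCommGroup V] [NormedSpace ℝ V]
    [CompleteSpace V] {Q : Set E2} (hQ : IsCompact Q) (hconv : Convex ℝ Q)
    (hpos : 0 < volume Q) {q : ℝ} (hq : 2 < q) {G : E2 → V} (hG : ContDiff ℝ 1 G)
    {h : E2 → ℝ} (hh : Continuous h) (hGh : ∀ z, ‖fderiv ℝ G z‖ ≤ h z)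
    {x x' : E2} (hx : x ∈ Q) (hx' : x' ∈ Q) :
    ‖G x - G x'‖ ≤ 2 * (q / (q - 2)) * Metric.diam Q *
      ((volume Q).toReal⁻¹ * ∫ z in Q, h z ^ q) ^ (1 / q) := by
  have hh0 : ∀ z, 0 ≤ h z := fun z => (norm_nonneg _).trans (hGh z)
  have hm := hQ.isClosed.measurableSet
  have hV : 0 < (volume Q).toReal := ENNReal.toReal_pos hpos.ne' hQ.measure_lt_top.ne
  have hGc : Continuous G := hG.continuous
  have hone : ∀ w ∈ Q, ∫ y in Q, ‖G w - G y‖ ≤ Metric.diam Q * ((volume Q).toReal *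
      (q / (q - 2)) * ((volume Q).toReal⁻¹ * ∫ z in Q, h z ^ q) ^ (1 / q)) := by
    intro w hw
    have hc : Continuous fun y => ∫ t in (0 : ℝ)..1, h (w + t • (y - w)) :=
      intervalIntegral.continuous_parametric_intervalIntegral_of_continuous' (by fun_prop) 0 1
    calc ∫ y in Q, ‖G w - G y‖
        ≤ ∫ y in Q, Metric.diam Q * ∫ t in (0 : ℝ)..1, h (w + t • (y - w)) := by
          refine setIntegral_mono_on (ContinuousOn.integrableOn_compact hQ (by fun_prop))
            (ContinuousOn.integrableOn_compact hQ (hc.const_mul _).continuousOn) hm fun y hy => ?_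
          refine (norm_sub_le_mul_integral hG hh hGh w y).trans ?_
          refine mul_le_mul_of_nonneg_right ?_
            (intervalIntegral.integral_nonneg zero_le_one fun t _ => hh0 _)
          rw [← dist_eq_norm]
          exact Metric.dist_le_diam_of_mem hQ.isBounded hy hw
      _ ≤ _ := by
          rw [integral_const_mul]
          exact mul_le_mul_of_nonneg_left
            (setIntegral_integral_segment_le hQ hconv hpos hq hh hh0 hw) Metric.diam_nonneg
  have hsum : (volume Q).toReal * ‖G x - G x'‖ ≤
      (∫ y in Q, ‖G x - G y‖) + ∫ y in Q, ‖G x' - G y‖ := by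
    rw [← integral_add (ContinuousOn.integrableOn_compact hQ (by fun_prop))
      (ContinuousOn.integrableOn_compact hQ (by fun_prop))]
    calc (volume Q).toReal * ‖G x - G x'‖ = ∫ _ in Q, ‖G x - G x'‖ := by
          simp [Measure.real]
      _ ≤ _ := by
          refine setIntegral_mono_on (ContinuousOn.integrableOn_compact hQ (by fun_prop))
            (ContinuousOn.integrableOn_compact hQ (by fun_prop)) hm fun y _ => ?_
          rw [norm_sub_rev (G x') (G y)]
          exact norm_sub_le_norm_sub_add_norm_sub _ _ _
  have h1 := hone x hx
  have h2 := hone x' hx'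
  refine le_of_mul_le_mul_left ?_ hV
  linarith

/-- A planar vector is controlled by its components along two sides of a triangle, with a constant
given by the circumradius and the length of the third side. -/
theorem dist_mul_norm_le_of_circumradius {a b c o w : E2} {R M : ℝ} (hac : a ≠ c) (hbc : b ≠ c)
    (ha : dist o a = R) (hb : dist o b = R) (hc : dist o c = R)
    (hwa : |⟪w, a - c⟫| ≤ M * ‖a - c‖) (hwb : |⟪w, b - c⟫| ≤ M * ‖b - c‖) :
    dist a b * ‖w‖ ≤ 4 * M * R := by
  have hR : 0 ≤ R := hc ▸ dist_nonneg
  obtain ⟨e, rfl⟩ : ∃ e, a = c + e := ⟨a - c, by simp⟩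
  obtain ⟨f, rfl⟩ : ∃ f, b = c + f := ⟨b - c, by simp⟩
  obtain ⟨p, rfl⟩ : ∃ p, o = c + p := ⟨o - c, by simp⟩
  have he : 0 < ‖e‖ := by simpa using hac
  have hf : 0 < ‖f‖ := by simpa using hbc
  simp only [add_sub_cancel_left, dist_add_left, dist_self_add_left] at *
  set K : ℝ := e 0 * f 1 - e 1 * f 0 with hK
  have nsq : ∀ u : E2, ‖u‖ ^ 2 = u 0 ^ 2 + u 1 ^ 2 := fun u => by
    rw [EuclideanSpace.norm_sq_eq]
    simp [Fin.sum_univ_two]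
  have inn : ∀ u u' : E2, ⟪u, u'⟫ = u 0 * u' 0 + u 1 * u' 1 := fun u u' => by
    simp [PiLp.inner_apply, Fin.sum_univ_two, mul_comm]
  have cross : ∀ u : E2, ‖u‖ * |K| = ‖⟪u, e⟫ • f - ⟪u, f⟫ • e‖ := by
    intro u
    refine (sq_eq_sq₀ (by positivity) (norm_nonneg _)).1 ?_
    rw [mul_pow, sq_abs, nsq, nsq, inn, inn]
    simp [hK]
    ring
  have hpe : ⟪p, e⟫ = ‖e‖ ^ 2 / 2 := by
    have h1 : ‖p - e‖ ^ 2 = ‖p‖ ^ 2 := by rw [← dist_eq_norm, ha, hc]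
    rw [norm_sub_sq_real] at h1
    linarith
  have hpf : ⟪p, f⟫ = ‖f‖ ^ 2 / 2 := by
    have h1 : ‖p - f‖ ^ 2 = ‖p‖ ^ 2 := by rw [← dist_eq_norm, hb, hc]
    rw [norm_sub_sq_real] at h1
    linarith
  have harea : 2 * R * |K| = ‖e‖ * ‖f‖ * ‖e - f‖ := by
    have h1 := cross p
    have h2 : 2 * ‖⟪p, e⟫ • f - ⟪p, f⟫ • e‖ = ‖e‖ * ‖f‖ * ‖e - f‖ := by
      refine (sq_eq_sq₀ (by positivity) (by positivity)).1 ?_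
      rw [hpe, hpf]
      simp only [mul_pow, nsq, PiLp.sub_apply, PiLp.smul_apply, smul_eq_mul]
      ring
    rw [hc] at h1
    linarith
  have hw : ‖w‖ * |K| ≤ 2 * M * (‖e‖ * ‖f‖) := by
    rw [cross w]
    refine (norm_sub_le _ _).trans ?_
    rw [norm_smul, norm_smul, Real.norm_eq_abs, Real.norm_eq_abs]
    have h1 := mul_le_mul_of_nonneg_right hwa hf.le
    have h2 := mul_le_mul_of_nonneg_right hwb he.le
    linarith
  refine le_of_mul_le_mul_left ?_ (mul_pos he hf)
  rw [dist_eq_norm]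
  calc ‖e‖ * ‖f‖ * (‖e - f‖ * ‖w‖) = 2 * R * (‖w‖ * |K|) := by
        rw [← mul_assoc, ← harea]
        ring
    _ ≤ 2 * R * (2 * M * (‖e‖ * ‖f‖)) := by gcongr
    _ = ‖e‖ * ‖f‖ * (4 * M * R) := by ring

theorem diam_mul_norm_le_of_circumradius {z₁ z₂ z₃ o w : E2} {R M : ℝ} (h12 : z₁ ≠ z₂)
    (h13 : z₁ ≠ z₃) (h23 : z₂ ≠ z₃) (h1 : dist o z₁ = R) (h2 : dist o z₂ = R)
    (h3 : dist o z₃ = R) (hM : 0 ≤ M)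
    (hw : ∀ a ∈ ({z₁, z₂, z₃} : Set E2), ∀ b ∈ ({z₁, z₂, z₃} : Set E2),
      |⟪w, a - b⟫| ≤ M * ‖a - b‖) :
    Metric.diam ({z₁, z₂, z₃} : Set E2) * ‖w‖ ≤ 4 * M * R := by
  have hR : 0 ≤ R := h1 ▸ dist_nonneg
  have hMR : 0 ≤ 4 * M * R := by positivity
  rcases (norm_nonneg w).eq_or_lt with hw0 | hw0
  · rwa [← hw0, mul_zero]
  rw [← le_div_iff₀ hw0]
  have hd12 := dist_mul_norm_le_of_circumradius h13 h23 h1 h2 h3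
    (hw z₁ (by simp) z₃ (by simp)) (hw z₂ (by simp) z₃ (by simp))
  have hd13 := dist_mul_norm_le_of_circumradius h12 h23.symm h1 h3 h2
    (hw z₁ (by simp) z₂ (by simp)) (hw z₃ (by simp) z₂ (by simp))
  have hd23 := dist_mul_norm_le_of_circumradius h12.symm h13.symm h2 h3 h1
    (hw z₂ (by simp) z₁ (by simp)) (hw z₃ (by simp) z₁ (by simp))
  refine Metric.diam_le_of_forall_dist_le (by positivity) ?_
  simp only [Set.mem_insert_iff, Set.mem_singleton_iff]
  rintro a (rfl | rfl | rfl) b (rfl | rfl | rfl) <;>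
    rw [le_div_iff₀ hw0] <;>
    first
    | simpa using hMR
    | assumption
    | (rw [dist_comm]; assumption)

/-- Proposition 3.4 ("TR1"): for `2 < q < ∞` there is `C = C(q)` such that for every `C²`
function `F : ℝ² → ℝ`, every triangle `Δ = {z₁, z₂, z₃}` (with circumcenter `o` and
circumradius `R`), every square `Q = Q(c,r) ⊇ Δ` and every `x ∈ Q`,
`‖∇P_Δ[F] − ∇F(x)‖₂ ≤ C (R/diam Δ) diam Q ((1/|Q|) ∫_Q |∇²F|^q)^{1/q}`,
where `P_Δ[F](y) = c₀ + ⟪v, y⟫` is the affine polynomial interpolating `F` at the vertices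
of `Δ` and `∇P_Δ[F] = v`. -/
theorem stmt12 (q : ℝ) (hq : 2 < q) :
    ∃ C : ℝ, 0 < C ∧
      ∀ (F : E2 → ℝ), ContDiff ℝ 2 F →
      ∀ z₁ z₂ z₃ : E2, ¬ Collinear ℝ ({z₁, z₂, z₃} : Set E2) →
      ∀ (c : E2) (r : ℝ), 0 < r → ({z₁, z₂, z₃} : Set E2) ⊆ square c r →
      ∀ x ∈ square c r,
      ∀ (o : E2) (R : ℝ), 0 < R → dist o z₁ = R → dist o z₂ = R → dist o z₃ = R →
      ∀ (c₀ : ℝ) (v : E2),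
        c₀ + ⟪v, z₁⟫ = F z₁ → c₀ + ⟪v, z₂⟫ = F z₂ → c₀ + ⟪v, z₃⟫ = F z₃ →
        ‖v - gradient F x‖ ≤
          C * (R / Metric.diam ({z₁, z₂, z₃} : Set E2)) * Metric.diam (square c r) *
            ((volume (square c r)).toReal⁻¹ * ∫ z in square c r, hessNorm F z ^ q) ^ (1 / q) := by
  have hq2 : 0 < q - 2 := by linarith
  refine ⟨8 * (q / (q - 2)), by positivity, ?_⟩
  intro F hF z₁ z₂ z₃ hcol c r hr hsub x hx o R hR h1 h2 h3 c₀ v hv1 hv2 hv3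
  have h12 : z₁ ≠ z₂ := by
    rintro rfl
    exact hcol (by simpa using collinear_pair ℝ z₁ z₃)
  have h13 : z₁ ≠ z₃ := by
    rintro rfl
    exact hcol (by simpa [Set.pair_comm] using collinear_pair ℝ z₁ z₂)
  have h23 : z₂ ≠ z₃ := by
    rintro rfl
    exact hcol (by simpa using collinear_pair ℝ z₁ z₂)
  set A := ((volume (square c r)).toReal⁻¹ * ∫ z in square c r, hessNorm F z ^ q) ^ (1 / q)
    with hA
  have hA0 : 0 ≤ A := Real.rpow_nonneg (mul_nonneg (by positivity)
    (integral_nonneg fun z => Real.rpow_nonneg (Real.sqrt_nonneg _) q)) _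
  set M := 2 * (q / (q - 2)) * Metric.diam (square c r) * A with hM
  have hM0 : 0 ≤ M := by
    have := Metric.diam_nonneg (s := square c r)
    positivity
  have hosc : ∀ y ∈ square c r, ‖fderiv ℝ F y - fderiv ℝ F x‖ ≤ M := fun y hy =>
    norm_sub_le_of_convex (isCompact_square c hr.le) (convex_square c r) (volume_square_pos c hr)
      hq (hF.fderiv_right (by norm_num)) (continuous_hessNorm hF)
      (norm_fderiv_fderiv_le_hessNorm F) hy hx
  have hvF : ∀ a ∈ ({z₁, z₂, z₃} : Set E2), c₀ + ⟪v, a⟫ = F a := by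
    rintro a (rfl | rfl | rfl) <;> assumption
  have hw : ∀ a ∈ ({z₁, z₂, z₃} : Set E2), ∀ b ∈ ({z₁, z₂, z₃} : Set E2),
      |⟪v - gradient F x, a - b⟫| ≤ M * ‖a - b‖ := by
    intro a ha b hb
    have hmv := (convex_square c r).norm_image_sub_le_of_norm_fderiv_le'
      (fun y _ => (hF.differentiable two_ne_zero) y) hosc (hsub hb) (hsub ha)
    have hgrad : ⟪gradient F x, a - b⟫ = fderiv ℝ F x (a - b) := by
      simp [gradient]
    rw [inner_sub_left, hgrad, inner_sub_right]
    rw [Real.norm_eq_abs, ← hvF a ha, ← hvF b hb, add_sub_add_left_eq_sub] at hmv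
    exact hmv
  have hmain := diam_mul_norm_le_of_circumradius h12 h13 h23 h1 h2 h3 hM0 hw
  have hd : 0 < Metric.diam ({z₁, z₂, z₃} : Set E2) :=
    (dist_pos.2 h12).trans_le
      (Metric.dist_le_diam_of_mem (Set.toFinite _).isBounded (by simp) (by simp))
  calc ‖v - gradient F x‖ ≤ 4 * M * R / Metric.diam ({z₁, z₂, z₃} : Set E2) := by
        rw [le_div_iff₀ hd, mul_comm]
        exact hmain
    _ = _ := by
        rw [hM]
        ring
end
end
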